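/- For all n ∈ ℕ, α > 1, δ > 0 and ρ < γ < 1 there is k > 0 such that for all y ∈ ℝⁿ with ‖y‖ > k and all t ∈ [‖y‖^ρ, ‖y‖^γ]: −‖y‖·(α·g(‖y‖/t)^{α−1} − (1−δ)·g(‖y‖/t)⁻¹) ≤ ln μ_t(y) ≤ −‖y‖·(α·g(‖y‖/t)^{α−1} − (1+δ)·g(‖y‖/t)⁻¹), where g is the solution of the functional equation given in the context. Moreover g is slowly varying and Λ ↦ g(e^Λ) is smoothly regularly varying of index 1/α. -/

import Mathlib

open MeasureTheory Filter Real Set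
open scoped Topology BigOperators ENNReal

noncomputable section

/-- `f` is smoothly regularly varying of index `α`. -/
def SmoothRegVary (α : ℝ) (f : ℝ → ℝ) : Prop :=
  ∃ z₀ : ℝ, 1 ≤ z₀ ∧ (∀ x, z₀ < x → 0 < f x) ∧
    ContDiffOn ℝ (⊤ : ℕ∞) f (Set.Ioi z₀) ∧
    Filter.Tendsto (deriv (fun u => Real.log (f (Real.exp u)))) Filter.atTop (nhds α) ∧
    ∀ m : ℕ, 2 ≤ m →
      Filter.Tendsto (iteratedDeriv m (fun u => Real.log (f (Real.exp u))))
        Filter.atTop (nhds 0)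

/-- `convPow n p m` is the `(m+1)`-fold convolution power of the density `p` on `ℝⁿ`. -/
def convPow (n : ℕ) (p : EuclideanSpace ℝ (Fin n) → ℝ) : ℕ → EuclideanSpace ℝ (Fin n) → ℝ
  | 0 => p
  | m + 1 => fun x => ∫ y, convPow n p m (x - y) * p y

/-- The density of the time-`t` marginal of the compound Poisson process with jump measure
`ν(dz) = exp(-‖z‖^α) dz` (of total mass `a`): `μ_t(y) = e^{-a t} Σ_{m≥1} tᵐ/m! p_m(y)`. -/
def weibullCPDensity (n : ℕ) (α : ℝ) (t : ℝ) (y : EuclideanSpace ℝ (Fin n)) : ℝ :=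
  Real.exp (-(∫ z : EuclideanSpace ℝ (Fin n), Real.exp (-‖z‖ ^ α)) * t) *
    ∑' m : ℕ, t ^ (m + 1) / (Nat.factorial (m + 1) : ℝ) *
      convPow n (fun z => Real.exp (-‖z‖ ^ α)) m y

section ExpAddLinear

variable {α c₁ c₂ c₃ X₀ : ℝ} {k : ℝ → ℝ}

lemma tendsto_atTop_of_exp_add_linear (hα : 1 < α) (hc₃ : 0 < c₃)
    (hk0 : ∀ x, X₀ < x → 0 < k x)
    (hk : ∀ x, X₀ < x → exp (α * k x) + c₁ * k x = c₂ + c₃ * x) :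
    Tendsto k atTop atTop := by
  have h1 : ∀ x, X₀ < x → c₂ + c₃ * x ≤ (1 + |c₁|) * exp (α * k x) := by
    intro x hx
    rw [← hk x hx]
    have h2 : k x ≤ exp (α * k x) := by
      have := add_one_le_exp (α * k x)
      nlinarith [hk0 x hx]
    have h3 : c₁ * k x ≤ |c₁| * exp (α * k x) :=
      mul_le_mul (le_abs_self _) h2 (hk0 x hx).le (abs_nonneg _)
    linarith
  have h4 : Tendsto (fun x => (1 + |c₁|) * exp (α * k x)) atTop atTop := by
    refine tendsto_atTop_mono' atTop ?_
      (tendsto_atTop_add_const_left atTop c₂ (tendsto_id.const_mul_atTop hc₃))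
    filter_upwards [eventually_gt_atTop X₀] with x hx using h1 x hx
  have h5 : Tendsto (fun x => exp (α * k x)) atTop atTop :=
    (tendsto_const_mul_atTop_of_pos (by positivity)).1 h4
  exact (tendsto_const_mul_atTop_of_pos (by linarith)).1 (tendsto_exp_comp_atTop.1 h5)

lemma hasDerivAt_exp_add_linear (s : ℝ) :
    HasDerivAt (fun s => exp (α * s) + c₁ * s) (α * exp (α * s) + c₁) s := by
  have h1 : HasDerivAt (fun s => α * s) α s := by simpa using (hasDerivAt_id s).const_mul α
  have h2 : HasDerivAt (fun s => c₁ * s) c₁ s := by simpa using (hasDerivAt_id s).const_mul c₁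
  exact (h1.exp.add h2).congr_deriv (by ring)

lemma tendsto_exp_deriv_atTop (hα : 1 < α) :
    Tendsto (fun s => α * exp (α * s) + c₁) atTop atTop := by
  have hα0 : 0 < α := by linarith
  exact tendsto_atTop_add_const_right _ _ ((tendsto_exp_atTop.comp
    (tendsto_id.const_mul_atTop hα0)).const_mul_atTop hα0)

lemma exists_hasDerivAt_of_exp_add_linear (hα : 1 < α) (hc₃ : 0 < c₃)
    (hk0 : ∀ x, X₀ < x → 0 < k x)
    (hk : ∀ x, X₀ < x → exp (α * k x) + c₁ * k x = c₂ + c₃ * x) :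
    ∃ X₁, X₀ ≤ X₁ ∧ ∀ x, X₁ < x → 1 ≤ α * exp (α * k x) + c₁ ∧
      HasDerivAt k (c₃ / (α * exp (α * k x) + c₁)) x := by
  have ht := tendsto_atTop_of_exp_add_linear hα hc₃ hk0 hk
  obtain ⟨s₁, hs₁⟩ := eventually_atTop.1
    ((tendsto_exp_deriv_atTop (c₁ := c₁) hα).eventually_ge_atTop 1)
  obtain ⟨X, hX⟩ := eventually_atTop.1 (ht.eventually_ge_atTop s₁)
  refine ⟨max X X₀, le_max_right _ _, fun x hx => ?_⟩
  have hXx : X < x := lt_of_le_of_lt (le_max_left _ _) hx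
  have hX₀x : X₀ < x := lt_of_le_of_lt (le_max_right _ _) hx
  have hmono : MonotoneOn (fun s => (exp (α * s) + c₁ * s) - s) (Ici s₁) := by
    have hd : ∀ s, HasDerivAt (fun s => (exp (α * s) + c₁ * s) - s)
        ((α * exp (α * s) + c₁) - 1) s :=
      fun s => (hasDerivAt_exp_add_linear s).sub (hasDerivAt_id s)
    refine monotoneOn_of_deriv_nonneg (convex_Ici _)
      (fun s _ => (hd s).continuousAt.continuousWithinAt)
      (fun s _ => (hd s).differentiableAt.differentiableWithinAt) fun s hs => ?_
    rw [interior_Ici] at hs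
    rw [(hd s).deriv]
    linarith [hs₁ s (le_of_lt hs)]
  have hlip : ∀ x', max X X₀ < x' → |k x' - k x| ≤ c₃ * |x' - x| := by
    have key : ∀ a b, max X X₀ < a → max X X₀ < b → k a ≤ k b →
        |k b - k a| ≤ c₃ * |b - a| := by
      intro a b ha hb hab
      have h1 := hmono (hX a ((le_max_left _ _).trans ha.le))
        (hX b ((le_max_left _ _).trans hb.le)) hab
      simp only [hk a ((le_max_right _ _).trans_lt ha), hk b ((le_max_right _ _).trans_lt hb)]
        at h1
      rw [abs_of_nonneg (sub_nonneg.2 hab)]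
      nlinarith [le_abs_self (b - a)]
    intro x' hx'
    rcases le_total (k x) (k x') with h | h
    · exact key x x' hx hx' h
    · rw [abs_sub_comm (k x'), abs_sub_comm x']
      exact key x' x hx' hx h
  have hcont : ContinuousAt k x := by
    rw [ContinuousAt, tendsto_iff_dist_tendsto_zero]
    have h0 : Tendsto (fun x' => c₃ * |x' - x|) (𝓝 x) (𝓝 0) := by
      have : Continuous fun x' => c₃ * |x' - x| := by fun_prop
      simpa using this.tendsto x
    refine squeeze_zero' (Eventually.of_forall fun _ => dist_nonneg) ?_ h0
    filter_upwards [lt_mem_nhds hx] with x' hx'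
    exact hlip x' hx'
  have hpos := hs₁ (k x) (hX x hXx.le)
  refine ⟨hpos, ?_⟩
  have hd : HasDerivAt (fun s => ((exp (α * s) + c₁ * s) - c₂) / c₃)
      ((α * exp (α * k x) + c₁) / c₃) (k x) :=
    ((hasDerivAt_exp_add_linear (k x)).sub_const c₂).div_const c₃
  have := HasDerivAt.of_local_left_inverse hcont hd (by positivity) (by
    filter_upwards [lt_mem_nhds hX₀x] with x' hx'
    rw [hk x' hx']
    field_simp
    ring)
  rwa [inv_div] at this

lemma contDiffOn_of_autonomous {F : ℝ → ℝ} {s : Set ℝ} {t : Set ℝ} (hs : IsOpen s)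
    (hF : ContDiffOn ℝ (⊤ : ℕ∞) F t) (hkt : MapsTo k s t)
    (hk : ∀ x ∈ s, HasDerivAt k (F (k x)) x) : ContDiffOn ℝ (⊤ : ℕ∞) k s := by
  rw [contDiffOn_infty]
  intro m
  induction m with
  | zero =>
    exact contDiffOn_zero.2 fun x hx => (hk x hx).continuousAt.continuousWithinAt
  | succ m ih =>
    push_cast
    rw [contDiffOn_succ_iff_deriv_of_isOpen hs]
    refine ⟨fun x hx => (hk x hx).differentiableAt.differentiableWithinAt, by simp, ?_⟩
    exact ((contDiffOn_infty.1 hF m).comp ih hkt).congr fun x hx => (hk x hx).deriv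

lemma tendsto_sub_of_tendsto_deriv_zero {k' : ℝ → ℝ} {X : ℝ}
    (hd : ∀ x, X < x → HasDerivAt k (k' x) x) (h0 : Tendsto k' atTop (𝓝 0)) (c : ℝ) :
    Tendsto (fun x => k (x + c) - k x) atTop (𝓝 0) := by
  rw [Metric.tendsto_atTop]
  intro ε hε
  obtain ⟨N, hN⟩ := (Metric.tendsto_atTop.1 h0) (ε / (|c| + 1)) (by positivity)
  refine ⟨max N X + |c| + 1, fun x hx => ?_⟩
  have hmem : ∀ z ∈ Ioi (max N X), X < z ∧ N ≤ z := fun z hz =>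
    ⟨(le_max_right _ _).trans_lt hz, (le_max_left _ _).trans (le_of_lt hz)⟩
  have hx1 : x ∈ Ioi (max N X) := by
    simp only [mem_Ioi]; linarith [abs_nonneg c]
  have hx2 : x + c ∈ Ioi (max N X) := by
    simp only [mem_Ioi]; linarith [neg_abs_le c]
  have := (convex_Ioi (max N X)).norm_image_sub_le_of_norm_deriv_le (f := k)
    (C := ε / (|c| + 1)) (fun z hz => (hd z (hmem z hz).1).differentiableAt)
    (fun z hz => by
      rw [(hd z (hmem z hz).1).deriv]
      simpa using (hN z (hmem z hz).2).le) hx1 hx2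
  rw [add_sub_cancel_left] at this
  rw [dist_zero_right]
  refine this.trans_lt ?_
  rw [Real.norm_eq_abs, div_mul_eq_mul_div, div_lt_iff₀ (by positivity)]
  nlinarith

lemma pow_mul_pow_mem_hasDerivAt {h W : ℝ → ℝ} {u₀ a b c d e : ℝ}
    (hh : ∀ u, u₀ < u → HasDerivAt h (a + (b * h u + c) * W u) u)
    (hW : ∀ u, u₀ < u → HasDerivAt W ((d * W u + e * W u ^ 2) * (a + (b * h u + c) * W u)) u)
    {F : ℝ → ℝ}
    (hF : F ∈ Submodule.span ℝ (range fun p : ℕ × ℕ => fun u => h u ^ p.1 * W u ^ (p.2 + 1))) :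
    ∃ F' ∈ Submodule.span ℝ (range fun p : ℕ × ℕ => fun u => h u ^ p.1 * W u ^ (p.2 + 1)),
      ∀ u, u₀ < u → HasDerivAt F (F' u) u := by
  set V := Submodule.span ℝ (range fun p : ℕ × ℕ => fun u => h u ^ p.1 * W u ^ (p.2 + 1)) with hV
  have hmono : ∀ i j : ℕ, (fun u => h u ^ i * W u ^ (j + 1)) ∈ V := fun i j =>
    Submodule.subset_span ⟨(i, j), rfl⟩
  induction hF using Submodule.span_induction with
  | mem F hF =>
    obtain ⟨⟨i, j⟩, rfl⟩ := hF
    let M : ℕ → ℕ → ℝ → ℝ := fun i j u => h u ^ i * W u ^ (j + 1)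
    have hM : ∀ i j, M i j ∈ V := hmono
    refine ⟨(i : ℝ) • (a • M (i - 1) j + b • M (i - 1 + 1) (j + 1) + c • M (i - 1) (j + 1)) +
      ((j : ℝ) + 1) • ((a * d) • M i j + (b * d) • M (i + 1) (j + 1) + (c * d) • M i (j + 1) +
        ((a * e) • M i (j + 1) + (b * e) • M (i + 1) (j + 2) + (c * e) • M i (j + 2))), ?_, ?_⟩
    · refine V.add_mem (V.smul_mem _ (V.add_mem (V.add_mem ?_ ?_) ?_))
        (V.smul_mem _ (V.add_mem (V.add_mem (V.add_mem ?_ ?_) ?_)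
          (V.add_mem (V.add_mem ?_ ?_) ?_))) <;> exact V.smul_mem _ (hM _ _)
    · intro u hu
      refine (((hh u hu).pow i).mul ((hW u hu).pow (j + 1))).congr_deriv ?_
      simp only [M, Pi.add_apply, Pi.smul_apply, smul_eq_mul, Pi.pow_apply]
      push_cast
      ring
  | zero => exact ⟨0, V.zero_mem, fun u _ => hasDerivAt_const u 0⟩
  | add F G _ _ hF hG =>
    obtain ⟨F', hF', hF⟩ := hF
    obtain ⟨G', hG', hG⟩ := hG
    exact ⟨F' + G', V.add_mem hF' hG', fun u hu => (hF u hu).add (hG u hu)⟩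
  | smul r F _ hF =>
    obtain ⟨F', hF', hF⟩ := hF
    exact ⟨r • F', V.smul_mem _ hF', fun u hu => (hF u hu).const_smul r⟩

lemma tendsto_zero_of_mem_span {h W : ℝ → ℝ}
    (hhW : ∀ i : ℕ, Tendsto (fun u => h u ^ i * W u) atTop (𝓝 0)) {F : ℝ → ℝ}
    (hF : F ∈ Submodule.span ℝ (range fun p : ℕ × ℕ => fun u => h u ^ p.1 * W u ^ (p.2 + 1))) :
    Tendsto F atTop (𝓝 0) := by
  induction hF using Submodule.span_induction with
  | mem F hF =>
    obtain ⟨⟨i, j⟩, rfl⟩ := hF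
    have h1 : Tendsto W atTop (𝓝 0) := by simpa using hhW 0
    have h2 : Tendsto (fun u => h u ^ i * W u * W u ^ j) atTop (𝓝 (0 * 0 ^ j)) :=
      (hhW i).mul (h1.pow j)
    rw [zero_mul] at h2
    refine h2.congr fun u => ?_
    ring
  | zero => exact tendsto_const_nhds
  | add F G _ _ hF hG => simpa [Pi.add_def] using hF.add hG
  | smul r F _ hF => simpa [Pi.smul_def] using hF.const_smul r

lemma tendsto_pow_mul_inv_exp_deriv (hα : 1 < α) (i : ℕ) :
    Tendsto (fun s => s ^ i * (α * exp (α * s) + c₁)⁻¹) atTop (𝓝 0) := by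
  have hα0 : 0 < α := by linarith
  have h1 : Tendsto (fun s => s ^ i * exp (-s)) atTop (𝓝 0) :=
    tendsto_pow_mul_exp_neg_atTop_nhds_zero i
  refine squeeze_zero' ?_ ?_ h1
  · filter_upwards [(tendsto_exp_deriv_atTop (c₁ := c₁) hα).eventually_gt_atTop 0,
      eventually_ge_atTop 0] with s hs hs0
    positivity
  · have h2 : Tendsto (fun s => exp s * (α - 1) + c₁) atTop atTop :=
      tendsto_atTop_add_const_right _ _ (tendsto_exp_atTop.atTop_mul_const (by linarith))
    filter_upwards [h2.eventually_gt_atTop 0, eventually_ge_atTop 0] with s hs hs0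
    rw [exp_neg]
    refine mul_le_mul_of_nonneg_left ?_ (by positivity)
    refine inv_anti₀ (exp_pos _) ?_
    have : exp s ≤ exp (α * s) := exp_le_exp.2 (by nlinarith)
    nlinarith

lemma tendsto_deriv_comp_exp (hα : 1 < α) (hc₃ : 0 < c₃)
    (hk0 : ∀ x, X₀ < x → 0 < k x)
    (hk : ∀ x, X₀ < x → exp (α * k x) + c₁ * k x = c₂ + c₃ * x) :
    Tendsto (deriv fun u => k (exp u)) atTop (𝓝 α⁻¹) ∧
      ∀ m : ℕ, 2 ≤ m → Tendsto (iteratedDeriv m fun u => k (exp u)) atTop (𝓝 0) := by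
  have hα0 : α ≠ 0 := by linarith
  have ht := tendsto_atTop_of_exp_add_linear hα hc₃ hk0 hk
  obtain ⟨X₁, hX₁, hd⟩ := exists_hasDerivAt_of_exp_add_linear hα hc₃ hk0 hk
  set h : ℝ → ℝ := fun u => k (exp u) with hh
  set W : ℝ → ℝ := fun u => (α * exp (α * h u) + c₁)⁻¹ with hWdef
  have hht : Tendsto h atTop atTop := ht.comp tendsto_exp_atTop
  have hhW : ∀ i : ℕ, Tendsto (fun u => h u ^ i * W u) atTop (𝓝 0) := fun i =>
    (tendsto_pow_mul_inv_exp_deriv hα i).comp hht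
  obtain ⟨u₀, hu₀⟩ := eventually_atTop.1 (tendsto_exp_atTop.eventually_gt_atTop X₁)
  have hh' : ∀ u, u₀ < u → HasDerivAt h (α⁻¹ + (c₁ * h u + (-c₂ - c₁ * α⁻¹)) * W u) u := by
    intro u hu
    obtain ⟨h1, h2⟩ := hd _ (hu₀ u hu.le)
    refine (h2.comp u (hasDerivAt_exp u)).congr_deriv ?_
    have h3 := hk _ (hX₁.trans_lt (hu₀ u hu.le))
    have h4 : c₃ * exp u = exp (α * k (exp u)) + c₁ * k (exp u) - c₂ := by linarith
    have h5 : α * exp (α * k (exp u)) + c₁ ≠ 0 := by linarith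
    rw [div_mul_eq_mul_div, h4]
    simp only [hh, hWdef]
    field_simp
    ring
  have hW' : ∀ u, u₀ < u → HasDerivAt W (((-α) * W u + (α * c₁) * W u ^ 2) *
      (α⁻¹ + (c₁ * h u + (-c₂ - c₁ * α⁻¹)) * W u)) u := by
    intro u hu
    have h1 := (hd _ (hu₀ u hu.le)).1
    have h5 : α * exp (α * h u) + c₁ ≠ 0 := by simp only [hh]; linarith
    have h6 : HasDerivAt (fun u => α * exp (α * h u) + c₁) _ u :=
      (((hh' u hu).const_mul α).exp.const_mul α).add_const c₁
    refine (h6.inv h5).congr_deriv ?_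
    simp only [hWdef]
    field_simp
    ring
  have hder : ∀ u, u₀ < u → deriv h u = α⁻¹ + (c₁ * h u + (-c₂ - c₁ * α⁻¹)) * W u :=
    fun u hu => (hh' u hu).deriv
  set V := Submodule.span ℝ (range fun p : ℕ × ℕ => fun u => h u ^ p.1 * W u ^ (p.2 + 1)) with hV
  have hmono : ∀ i j : ℕ, (fun u => h u ^ i * W u ^ (j + 1)) ∈ V := fun i j =>
    Submodule.subset_span ⟨(i, j), rfl⟩
  have hG : (fun u => (c₁ * h u + (-c₂ - c₁ * α⁻¹)) * W u) ∈ V := by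
    convert V.add_mem (V.smul_mem c₁ (hmono 1 0)) (V.smul_mem (-c₂ - c₁ * α⁻¹) (hmono 0 0)) using 1
    ext u
    simp
    ring
  constructor
  · have h1 := (tendsto_zero_of_mem_span hhW hG).const_add α⁻¹
    rw [add_zero] at h1
    refine h1.congr' ?_
    filter_upwards [eventually_gt_atTop u₀] with u hu using (hder u hu).symm
  · have hev : ∀ {P Q : ℝ → ℝ}, (∀ u, u₀ < u → P u = Q u) → ∀ u, u₀ < u → P =ᶠ[𝓝 u] Q := by
      intro P Q hPQ u hu
      filter_upwards [lt_mem_nhds hu] with v hv using hPQ v hv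
    have key : ∀ m : ℕ, ∃ F ∈ V, ∀ u, u₀ < u → iteratedDeriv (m + 2) h u = F u := by
      intro m
      induction m with
      | zero =>
        obtain ⟨F', hF', hF⟩ := pow_mul_pow_mem_hasDerivAt hh' hW' hG
        refine ⟨F', hF', fun u hu => ?_⟩
        rw [zero_add, iteratedDeriv_succ, iteratedDeriv_one, (hev hder u hu).deriv_eq]
        exact ((hF u hu).const_add _).deriv
      | succ m ih =>
        obtain ⟨F, hFV, hF⟩ := ih
        obtain ⟨F', hF', hd'⟩ := pow_mul_pow_mem_hasDerivAt hh' hW' hFV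
        refine ⟨F', hF', fun u hu => ?_⟩
        rw [show m + 1 + 2 = (m + 2) + 1 by ring, iteratedDeriv_succ, (hev hF u hu).deriv_eq]
        exact (hd' u hu).deriv
    intro m hm
    obtain ⟨F, hFV, hF⟩ := key (m - 2)
    rw [show m - 2 + 2 = m by omega] at hF
    refine (tendsto_zero_of_mem_span hhW hFV).congr' ?_
    filter_upwards [eventually_gt_atTop u₀] with u hu using (hF u hu).symm

lemma smoothRegVary_of_exp_add_linear (hα : 1 < α) (hc₃ : 0 < c₃)
    (hk0 : ∀ x, X₀ < x → 0 < k x)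
    (hk : ∀ x, X₀ < x → exp (α * k x) + c₁ * k x = c₂ + c₃ * x) {f : ℝ → ℝ}
    (hf : ∀ x, X₀ < x → f x = exp (k x)) : SmoothRegVary α⁻¹ f := by
  obtain ⟨X₁, hX₁, hd⟩ := exists_hasDerivAt_of_exp_add_linear hα hc₃ hk0 hk
  obtain ⟨h1, h2⟩ := tendsto_deriv_comp_exp hα hc₃ hk0 hk
  obtain ⟨u₀, hu₀⟩ := eventually_atTop.1 (tendsto_exp_atTop.eventually_gt_atTop X₀)
  have hev : ∀ u, u₀ < u → (fun u => log (f (exp u))) =ᶠ[𝓝 u] fun u => k (exp u) := by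
    intro u hu
    filter_upwards [lt_mem_nhds hu] with v hv
    rw [hf _ (hu₀ v hv.le), log_exp]
  refine ⟨max 1 X₁, le_max_left _ _, fun x hx => ?_, ?_, ?_, fun m hm => ?_⟩
  · rw [hf x (hX₁.trans_lt ((le_max_right _ _).trans_lt hx))]
    exact exp_pos _
  · have hk' : ContDiffOn ℝ (⊤ : ℕ∞) k (Ioi (max 1 X₁)) := by
      refine contDiffOn_of_autonomous (F := fun s => c₃ / (α * exp (α * s) + c₁))
        (t := {s | α * exp (α * s) + c₁ ≠ 0}) isOpen_Ioi ?_ ?_ ?_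
      · exact contDiffOn_const.div (by fun_prop) fun s hs => hs
      · intro x hx
        have := (hd x ((le_max_right _ _).trans_lt hx)).1
        simp only [mem_ofPred_eq]
        linarith
      · exact fun x hx => (hd x ((le_max_right _ _).trans_lt hx)).2
    exact hk'.exp.congr fun x hx => hf x (hX₁.trans_lt ((le_max_right _ _).trans_lt hx))
  · refine h1.congr' ?_
    filter_upwards [eventually_gt_atTop u₀] with u hu using (hev u hu).deriv_eq.symm
  · refine (h2 m hm).congr' ?_
    filter_upwards [eventually_gt_atTop u₀] with u hu using ((hev u hu).iteratedDeriv_eq m).symm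

lemma tendsto_exp_sub_of_exp_add_linear (hα : 1 < α) (hc₃ : 0 < c₃)
    (hk0 : ∀ x, X₀ < x → 0 < k x)
    (hk : ∀ x, X₀ < x → exp (α * k x) + c₁ * k x = c₂ + c₃ * x) (c : ℝ) :
    Tendsto (fun x => exp (k (x + c)) / exp (k x)) atTop (𝓝 1) := by
  obtain ⟨X₁, hX₁, hd⟩ := exists_hasDerivAt_of_exp_add_linear hα hc₃ hk0 hk
  have ht := tendsto_atTop_of_exp_add_linear hα hc₃ hk0 hk
  have h0 : Tendsto (fun x => c₃ / (α * exp (α * k x) + c₁)) atTop (𝓝 0) :=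
    ((tendsto_exp_deriv_atTop hα).comp ht).const_div_atTop c₃
  have h1 := tendsto_sub_of_tendsto_deriv_zero (fun x hx => (hd x hx).2) h0 c
  have h2 := (continuous_exp.tendsto 0).comp h1
  rw [exp_zero] at h2
  exact h2.congr fun x => by simp [exp_sub]

lemma exists_eventually_exp_le_of_exp_add_linear (hα : 1 < α) (hc₃ : 0 < c₃)
    (hk0 : ∀ x, X₀ < x → 0 < k x)
    (hk : ∀ x, X₀ < x → exp (α * k x) + c₁ * k x = c₂ + c₃ * x) :
    ∃ C > 0, ∀ᶠ x in atTop, exp (α * k x) ≤ C * x := by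
  refine ⟨2 * (|c₂| + c₃), by positivity, ?_⟩
  filter_upwards [eventually_gt_atTop X₀, eventually_ge_atTop 1,
    (tendsto_atTop_of_exp_add_linear hα hc₃ hk0 hk).eventually_ge_atTop (4 * |c₁|)] with x hx h1 h4
  have hs := hk0 x hx
  have h2 := quadratic_le_exp_of_nonneg (x := α * k x) (by positivity)
  have h3 : -(|c₁| * k x) ≤ c₁ * k x := by
    rw [← neg_mul]
    exact mul_le_mul_of_nonneg_right (neg_abs_le c₁) hs.le
  have h5 : k x ^ 2 ≤ (α * k x) ^ 2 := by
    refine pow_le_pow_left₀ hs.le ?_ 2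
    nlinarith
  have h6 : 4 * |c₁| * k x ≤ k x ^ 2 := by nlinarith
  have h7 : |c₂| ≤ |c₂| * x := le_mul_of_one_le_right (abs_nonneg _) h1
  have h8 := hk x hx
  have h9 : 0 ≤ α * k x := by positivity
  linarith [le_abs_self c₂]

end ExpAddLinear

section Laplace

lemma rpow_excess_pos {α s : ℝ} (hα : 1 < α) (hs : 0 ≤ s) (hs1 : s ≠ 1) :
    0 < s ^ α - 1 - α * (s - 1) := by
  have h := one_add_mul_self_lt_rpow_one_add (s := s - 1) (by linarith) (sub_ne_zero.2 hs1) hα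
  rw [add_sub_cancel] at h
  linarith

lemma tendsto_rpow_excess_div_sq (α : ℝ) :
    Tendsto (fun s : ℝ => (s ^ α - 1 - α * (s - 1)) / (s - 1) ^ 2) (𝓝[≠] 1)
      (𝓝 (α * (α - 1) / 2)) := by
  have hpos : ∀ᶠ s : ℝ in 𝓝[≠] 1, 0 < s :=
    eventually_nhdsWithin_of_eventually_nhds (lt_mem_nhds one_pos)
  have hd1 : ∀ s : ℝ, 0 < s → HasDerivAt (fun s : ℝ => s ^ α - 1 - α * (s - 1))
      (α * s ^ (α - 1) - α) s := fun s hs =>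
    (((hasDerivAt_rpow_const (Or.inl hs.ne')).sub_const 1).sub
      (((hasDerivAt_id s).sub_const 1).const_mul α)).congr_deriv (by simp)
  have hd2 : ∀ s : ℝ, HasDerivAt (fun s : ℝ => (s - 1) ^ 2) (2 * (s - 1)) s := fun s =>
    (((hasDerivAt_id s).sub_const 1).pow 2).congr_deriv (by simp)
  refine HasDerivAt.lhopital_zero_nhdsNE (f' := fun s => α * s ^ (α - 1) - α)
    (g' := fun s => 2 * (s - 1)) ?_ (Eventually.of_forall hd2) ?_ ?_ ?_ ?_
  · filter_upwards [hpos] with s hs using hd1 s hs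
  · filter_upwards [self_mem_nhdsWithin] with s hs
    exact mul_ne_zero two_ne_zero (sub_ne_zero.2 hs)
  · have := (hd1 1 one_pos).continuousAt.tendsto
    simp only [one_rpow, sub_self, mul_zero] at this
    exact this.mono_left nhdsWithin_le_nhds
  · have := (hd2 1).continuousAt.tendsto
    simp only [sub_self, ne_eq, OfNat.ofNat_ne_zero, not_false_eq_true, zero_pow] at this
    exact this.mono_left nhdsWithin_le_nhds
  · have h1 := (hasDerivAt_iff_tendsto_slope.1
      (hasDerivAt_rpow_const (x := 1) (p := α - 1) (Or.inl one_ne_zero))).const_mul (α / 2)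
    simp only [one_rpow, mul_one] at h1
    convert h1 using 1
    · ext s
      rw [slope_def_field]
      simp only [one_rpow]
      by_cases hs : s - 1 = 0
      · simp [hs]
      · field_simp
    · congr 1
      ring

lemma exists_le_rpow_excess {α : ℝ} (hα : 1 < α) :
    ∃ c > 0, ∀ s ∈ Icc (0 : ℝ) 2, c * (s - 1) ^ 2 ≤ s ^ α - 1 - α * (s - 1) := by
  set φ : ℝ → ℝ := Function.update (fun s : ℝ => (s ^ α - 1 - α * (s - 1)) / (s - 1) ^ 2) 1
    (α * (α - 1) / 2) with hφ
  have hcont : ContinuousOn φ (Icc 0 2) := by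
    intro s hs
    by_cases hs1 : s = 1
    · subst hs1
      exact (continuousAt_update_same.2 (tendsto_rpow_excess_div_sq α)).continuousWithinAt
    · refine ((continuousAt_update_of_ne hs1).2 ?_).continuousWithinAt
      refine ContinuousAt.div ?_ (by fun_prop) (pow_ne_zero 2 (sub_ne_zero.2 hs1))
      have : ContinuousAt (fun s : ℝ => s ^ α) s :=
        continuousAt_id.rpow_const (Or.inr (by linarith))
      fun_prop
  have hpos : ∀ s ∈ Icc (0 : ℝ) 2, 0 < φ s := by
    intro s hs
    by_cases hs1 : s = 1
    · subst hs1
      rw [hφ, Function.update_self]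
      nlinarith
    · rw [hφ, Function.update_of_ne hs1]
      have := sub_ne_zero.2 hs1
      exact div_pos (rpow_excess_pos hα hs.1 hs1) (by positivity)
  obtain ⟨s₀, hs₀, hmin⟩ := isCompact_Icc.exists_isMinOn ⟨0, by simp⟩ hcont
  refine ⟨φ s₀, hpos s₀ hs₀, fun s hs => ?_⟩
  by_cases hs1 : s = 1
  · simp [hs1]
  · have h1 : φ s₀ ≤ φ s := hmin hs
    have h2 : φ s = (s ^ α - 1 - α * (s - 1)) / (s - 1) ^ 2 := by
      rw [hφ, Function.update_of_ne hs1]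
    have := sub_ne_zero.2 hs1
    rwa [h2, le_div_iff₀ (by positivity)] at h1

section InnerProduct

variable {E : Type*} [NormedAddCommGroup E] [InnerProductSpace ℝ E] {e : E} {α : ℝ}

/-- The Bregman divergence of `‖·‖ ^ α` at a unit vector `e`. -/
def powBregman (α : ℝ) (e v : E) : ℝ := ‖e + v‖ ^ α - 1 - α * inner ℝ e v

lemma continuous_powBregman (hα : 1 < α) : Continuous (powBregman α e) := by
  unfold powBregman
  have : Continuous fun v : E => ‖e + v‖ ^ α :=
    (by fun_prop : Continuous fun v : E => ‖e + v‖).rpow_const fun _ => Or.inr (by linarith)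
  fun_prop

lemma powBregman_eq (he : ‖e‖ = 1) (v : E) :
    powBregman α e v = (‖e + v‖ ^ α - 1 - α * (‖e + v‖ - 1)) +
      α / 2 * (‖v‖ ^ 2 - (‖e + v‖ - 1) ^ 2) := by
  have h := norm_add_sq_real e v
  rw [he] at h
  unfold powBregman
  linear_combination (α / 2) * h

lemma exists_le_powBregman (hα : 1 < α) :
    ∃ c > 0, ∀ e v : E, ‖e‖ = 1 →
      (‖v‖ ≤ 1 → c * ‖v‖ ^ 2 ≤ powBregman α e v) ∧
      (1 ≤ ‖v‖ → c * ‖v‖ ≤ powBregman α e v) := by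
  obtain ⟨c, hc, h⟩ := exists_le_rpow_excess hα
  have hsmall : ∀ e v : E, ‖e‖ = 1 → ‖v‖ ≤ 1 →
      min c (α / 2) * ‖v‖ ^ 2 ≤ powBregman α e v := by
    intro e v he hv
    have h1 : |‖e + v‖ - 1| ≤ ‖v‖ := by
      have := abs_norm_sub_norm_le (e + v) e
      rwa [he, add_sub_cancel_left] at this
    have h2 : (‖e + v‖ - 1) ^ 2 ≤ ‖v‖ ^ 2 := by
      rw [← sq_abs (‖e + v‖ - 1)]
      gcongr
    have h3 := h ‖e + v‖ ⟨norm_nonneg _, by linarith [(abs_le.1 h1).2]⟩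
    rw [powBregman_eq he]
    have h4 := min_le_left c (α / 2)
    have h5 := min_le_right c (α / 2)
    nlinarith [mul_nonneg (sub_nonneg.2 h4) (sq_nonneg (‖e + v‖ - 1)),
      mul_nonneg (sub_nonneg.2 h5) (sub_nonneg.2 h2)]
  refine ⟨min c (α / 2), lt_min hc (by linarith), fun e v he => ⟨hsmall e v he, fun hv => ?_⟩⟩
  have hv0 : 0 < ‖v‖ := by linarith
  have hnorm : ‖‖v‖⁻¹ • v‖ = 1 := by
    rw [norm_smul, norm_inv, norm_norm, inv_mul_cancel₀ hv0.ne']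
  have h1 := hsmall e (‖v‖⁻¹ • v) he hnorm.le
  rw [hnorm, one_pow, mul_one] at h1
  have hinv : ‖v‖⁻¹ ≤ 1 := inv_le_one_of_one_le₀ hv
  have hinv0 : 0 ≤ ‖v‖⁻¹ := by positivity
  have h2 : ‖e + ‖v‖⁻¹ • v‖ ≤ ‖v‖⁻¹ * ‖e + v‖ + (1 - ‖v‖⁻¹) * 1 := by
    calc ‖e + ‖v‖⁻¹ • v‖ = ‖‖v‖⁻¹ • (e + v) + (1 - ‖v‖⁻¹) • e‖ := by congr 1; module
      _ ≤ _ := by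
        refine (norm_add_le _ _).trans (le_of_eq ?_)
        rw [norm_smul, norm_smul, he, Real.norm_of_nonneg hinv0,
          Real.norm_of_nonneg (sub_nonneg.2 hinv)]
  have h3 := (convexOn_rpow hα.le).2 (mem_Ici.2 (norm_nonneg (e + v)))
    (mem_Ici.2 zero_le_one) hinv0 (sub_nonneg.2 hinv) (add_sub_cancel _ _)
  simp only [smul_eq_mul, one_rpow] at h3
  have h4 := (rpow_le_rpow (norm_nonneg _) h2 (by linarith)).trans h3
  have h5 : powBregman α e (‖v‖⁻¹ • v) ≤ ‖v‖⁻¹ * powBregman α e v := by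
    unfold powBregman
    rw [inner_smul_right]
    linarith
  have h6 := h1.trans h5
  rw [inv_mul_eq_div, le_div_iff₀ hv0] at h6
  exact h6

lemma tendsto_powBregman_div_sq (he : ‖e‖ = 1) (u : E) :
    Tendsto (fun ε : ℝ => powBregman α e (ε • u) / ε ^ 2) (𝓝[>] 0)
      (𝓝 (α / 2 * ‖u‖ ^ 2 + α * (α - 2) / 2 * (inner ℝ e u) ^ 2)) := by
  set φ : ℝ → ℝ := Function.update (fun s : ℝ => (s ^ α - 1 - α * (s - 1)) / (s - 1) ^ 2) 1
    (α * (α - 1) / 2) with hφ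
  have hφeq : ∀ s, s ^ α - 1 - α * (s - 1) = φ s * (s - 1) ^ 2 := by
    intro s
    by_cases hs : s = 1
    · simp [hs]
    · rw [hφ, Function.update_of_ne hs]
      have := sub_ne_zero.2 hs
      field_simp
  have hs : Tendsto (fun ε : ℝ => ‖e + ε • u‖) (𝓝[>] 0) (𝓝 1) := by
    have : Continuous fun ε : ℝ => ‖e + ε • u‖ := by fun_prop
    simpa [he] using (this.tendsto 0).mono_left nhdsWithin_le_nhds
  have hφt : Tendsto (fun ε : ℝ => φ ‖e + ε • u‖) (𝓝[>] 0) (𝓝 (α * (α - 1) / 2)) := by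
    have h1 : ContinuousAt φ 1 := continuousAt_update_same.2 (tendsto_rpow_excess_div_sq α)
    have h2 := h1.tendsto.comp hs
    rwa [hφ, Function.update_self] at h2
  have hslope : Tendsto (fun ε : ℝ => (‖e + ε • u‖ - 1) / ε) (𝓝[>] 0) (𝓝 (inner ℝ e u)) := by
    have h1 : Tendsto (fun ε : ℝ => (2 * inner ℝ e u + ε * ‖u‖ ^ 2) / (‖e + ε • u‖ + 1))
        (𝓝[>] 0) (𝓝 ((2 * inner ℝ e u + 0 * ‖u‖ ^ 2) / (1 + 1))) := by
      refine Tendsto.div ?_ (hs.add_const 1) (by norm_num)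
      have : Continuous fun ε : ℝ => 2 * inner ℝ e u + ε * ‖u‖ ^ 2 := by fun_prop
      exact (this.tendsto 0).mono_left nhdsWithin_le_nhds
    have h2 : (2 * inner ℝ e u + 0 * ‖u‖ ^ 2) / (1 + 1) = (inner ℝ e u : ℝ) := by ring
    rw [h2] at h1
    refine h1.congr' ?_
    filter_upwards [self_mem_nhdsWithin] with ε hε
    have hε0 : ε ≠ 0 := ne_of_gt hε
    have h3 := norm_add_sq_real e (ε • u)
    rw [he, inner_smul_right, norm_smul, mul_pow, Real.norm_eq_abs, sq_abs] at h3
    rw [div_eq_div_iff (by positivity) hε0]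
    linear_combination -h3
  have h := (hφt.mul (hslope.pow 2)).add (((hslope.pow 2).const_sub (‖u‖ ^ 2)).const_mul (α / 2))
  have h' : α * (α - 1) / 2 * (inner ℝ e u) ^ 2 + α / 2 * (‖u‖ ^ 2 - (inner ℝ e u) ^ 2) =
      α / 2 * ‖u‖ ^ 2 + α * (α - 2) / 2 * (inner ℝ e u) ^ 2 := by ring
  rw [h'] at h
  refine h.congr' ?_
  filter_upwards [self_mem_nhdsWithin] with ε hε
  have hε0 : ε ≠ 0 := ne_of_gt hε
  rw [powBregman_eq he, hφeq, norm_smul, mul_pow, Real.norm_eq_abs, sq_abs]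
  field_simp

lemma eventually_mem_Ioc_nhdsGT_zero : ∀ᶠ ε : ℝ in 𝓝[>] 0, 0 < ε ∧ ε ≤ 1 := by
  filter_upwards [self_mem_nhdsWithin, eventually_nhdsWithin_of_eventually_nhds
    (ge_mem_nhds (zero_lt_one' ℝ))] with ε h1 h2 using ⟨h1, h2⟩

lemma tendsto_exp_neg_powBregman (he : ‖e‖ = 1) (u : E) :
    Tendsto (fun ε : ℝ => exp (-(powBregman α e (ε • u) / ε ^ 2))) (𝓝[>] 0)
      (𝓝 (exp (-(α / 2 * ‖u‖ ^ 2 + α * (α - 2) / 2 * (inner ℝ e u) ^ 2)))) :=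
  (continuous_exp.tendsto _).comp (tendsto_powBregman_div_sq he u).neg

lemma continuous_exp_neg_powBregman (hα : 1 < α) (ε : ℝ) :
    Continuous fun u : E => exp (-(powBregman α e (ε • u) / ε ^ 2)) := by
  have := (continuous_powBregman (e := e) hα).comp (continuous_const_smul ε)
  simp only [Function.comp_def] at this
  fun_prop

/-- The symmetrised and truncated rescaled Laplace integrand. -/
def symTrunc (α : ℝ) (e : E) (L ε : ℝ) : E → ℝ :=
  (Metric.closedBall (0 : E) L).indicator fun u =>
    min (exp (-(powBregman α e (ε • u) / ε ^ 2))) (exp (-(powBregman α e (ε • -u) / ε ^ 2)))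

lemma symTrunc_nonneg (L ε : ℝ) (u : E) : 0 ≤ symTrunc α e L ε u :=
  indicator_nonneg (fun _ _ => (lt_min (exp_pos _) (exp_pos _)).le) u

lemma symTrunc_le (L ε : ℝ) (u : E) :
    symTrunc α e L ε u ≤ exp (-(powBregman α e (ε • u) / ε ^ 2)) :=
  indicator_le' (fun _ _ => min_le_left _ _) (fun _ _ => (exp_pos _).le) u

lemma symTrunc_neg (L ε : ℝ) (u : E) : symTrunc α e L ε (-u) = symTrunc α e L ε u := by
  simp only [symTrunc, indicator, mem_closedBall_zero_iff, norm_neg, neg_neg, min_comm]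

lemma symTrunc_eq_zero {L ε : ℝ} {u : E} (hu : L < ‖u‖) : symTrunc α e L ε u = 0 :=
  indicator_of_notMem (by simpa using hu) _

lemma measurable_symTrunc [MeasurableSpace E] [BorelSpace E] (hα : 1 < α) (L ε : ℝ) : Measurable (symTrunc α e L ε) := by
  refine Measurable.indicator ?_ Metric.isClosed_closedBall.measurableSet
  exact ((continuous_exp_neg_powBregman hα ε).min
    ((continuous_exp_neg_powBregman hα ε).comp continuous_neg)).measurable

end InnerProduct

section Integral

variable {E : Type*} [NormedAddCommGroup E] [InnerProductSpace ℝ E] [FiniteDimensional ℝ E]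
  [MeasurableSpace E] [BorelSpace E] {e : E} {α : ℝ}

lemma integrable_exp_neg_mul_norm {c : ℝ} (hc : 0 < c) :
    Integrable fun x : E => exp (-(c * ‖x‖)) := by
  set N := Module.finrank ℝ E + 1 with hN
  have h1 : Integrable fun x : E => exp c * (N.factorial / c ^ N) * (1 + ‖x‖) ^ (-(N : ℝ)) :=
    (integrable_one_add_norm (by rw [hN]; push_cast; linarith)).const_mul _
  refine h1.mono' (by fun_prop) (Eventually.of_forall fun x => ?_)
  rw [Real.norm_of_nonneg (exp_pos _).le, rpow_neg (by positivity), rpow_natCast]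
  have h2 := pow_div_factorial_le_exp (x := c * (1 + ‖x‖)) (by positivity) N
  rw [div_le_iff₀ (by positivity), mul_pow, mul_add, mul_one, exp_add] at h2
  rw [exp_neg]
  have h3 : (0 : ℝ) < c ^ N := by positivity
  have h4 : 0 < (1 + ‖x‖) ^ N := by positivity
  rw [inv_le_iff_one_le_mul₀ (exp_pos _)]
  rw [show exp c * (N.factorial / c ^ N) * ((1 + ‖x‖) ^ N)⁻¹ * exp (c * ‖x‖) =
    (exp c * exp (c * ‖x‖) * N.factorial) / (c ^ N * (1 + ‖x‖) ^ N) by field_simp]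
  rw [le_div_iff₀ (by positivity), one_mul]
  exact h2

lemma exists_integrable_bound (hα : 1 < α) :
    ∃ G : E → ℝ, Integrable G ∧ ∀ e : E, ‖e‖ = 1 → ∀ ε : ℝ, 0 < ε → ε ≤ 1 → ∀ u,
      exp (-(powBregman α e (ε • u) / ε ^ 2)) ≤ G u := by
  obtain ⟨c, hc, h⟩ := exists_le_powBregman (E := E) hα
  refine ⟨fun u => exp c * exp (-(c * ‖u‖)), (integrable_exp_neg_mul_norm hc).const_mul _,
    fun e he ε hε hε1 u => ?_⟩
  simp only
  rw [← exp_add, exp_le_exp]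
  suffices c * (‖u‖ - 1) ≤ powBregman α e (ε • u) / ε ^ 2 by linarith
  rw [le_div_iff₀ (by positivity)]
  obtain ⟨h1, h2⟩ := h e (ε • u) he
  rw [norm_smul, Real.norm_of_nonneg hε.le] at h1 h2
  rcases le_total (ε * ‖u‖) 1 with hu | hu
  · refine le_trans ?_ (h1 hu)
    have : ‖u‖ - 1 ≤ ‖u‖ ^ 2 := by nlinarith [sq_nonneg (‖u‖ - 1), norm_nonneg u]
    rw [mul_pow, mul_comm (ε ^ 2), ← mul_assoc]
    gcongr
  · refine le_trans ?_ (h2 hu)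
    rw [mul_assoc]
    refine mul_le_mul_of_nonneg_left ?_ hc.le
    nlinarith [mul_nonneg hε.le (norm_nonneg u), mul_nonneg (mul_nonneg hε.le (norm_nonneg u)) (sub_nonneg.2 hε1), sq_nonneg ε]

lemma tendsto_integral_exp_neg_powBregman (hα : 1 < α) (he : ‖e‖ = 1) :
    Tendsto (fun ε : ℝ => ∫ u : E, exp (-(powBregman α e (ε • u) / ε ^ 2))) (𝓝[>] 0)
      (𝓝 (∫ u : E, exp (-(α / 2 * ‖u‖ ^ 2 + α * (α - 2) / 2 * (inner ℝ e u) ^ 2)))) := by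
  obtain ⟨G, hG, hle⟩ := exists_integrable_bound (E := E) hα
  refine tendsto_integral_filter_of_dominated_convergence G
    (Eventually.of_forall fun ε => (continuous_exp_neg_powBregman hα ε).aestronglyMeasurable) ?_ hG
    (Eventually.of_forall fun u => tendsto_exp_neg_powBregman he u)
  filter_upwards [eventually_mem_Ioc_nhdsGT_zero] with ε hε
  refine Eventually.of_forall fun u => ?_
  rw [Real.norm_of_nonneg (exp_pos _).le]
  exact hle e he ε hε.1 hε.2 u

lemma exists_eventually_lt_integral_symTrunc (hα : 1 < α) (he : ‖e‖ = 1) {I : ℝ}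
    (hI : I < ∫ u : E, exp (-(α / 2 * ‖u‖ ^ 2 + α * (α - 2) / 2 * (inner ℝ e u) ^ 2))) :
    ∃ L > 0, ∀ᶠ ε : ℝ in 𝓝[>] 0, I < ∫ u : E, symTrunc α e L ε u := by
  obtain ⟨G, hG, hle⟩ := exists_integrable_bound (E := E) hα
  set Γ : E → ℝ := fun u => exp (-(α / 2 * ‖u‖ ^ 2 + α * (α - 2) / 2 * (inner ℝ e u) ^ 2)) with hΓ
  have hΓm : Continuous Γ := by fun_prop
  have hΓG : ∀ u, ‖Γ u‖ ≤ G u := by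
    intro u
    rw [Real.norm_of_nonneg (exp_pos _).le]
    refine le_of_tendsto (tendsto_exp_neg_powBregman (α := α) he u) ?_
    filter_upwards [eventually_mem_Ioc_nhdsGT_zero] with ε hε using hle e he ε hε.1 hε.2 u
  have h1 : Tendsto (fun L : ℕ => ∫ u, (Metric.closedBall (0 : E) L).indicator Γ u) atTop
      (𝓝 (∫ u, Γ u)) := by
    refine tendsto_integral_of_dominated_convergence G
      (fun L => (hΓm.measurable.indicator
        Metric.isClosed_closedBall.measurableSet).aestronglyMeasurable) hG
      (fun L => Eventually.of_forall fun u => (norm_indicator_le_norm_self _ _).trans (hΓG u))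
      (Eventually.of_forall fun u => ?_)
    refine tendsto_const_nhds.congr' ?_
    obtain ⟨L₀, hL₀⟩ := exists_nat_ge ‖u‖
    filter_upwards [eventually_ge_atTop L₀] with L hL
    rw [indicator_of_mem]
    have : (L₀ : ℝ) ≤ L := by exact_mod_cast hL
    simpa using hL₀.trans this
  obtain ⟨L, hL, hL0⟩ := ((h1.eventually_const_lt hI).and (eventually_gt_atTop 0)).exists
  refine ⟨L, by exact_mod_cast hL0, ?_⟩
  have h2 : Tendsto (fun ε : ℝ => ∫ u : E, symTrunc α e L ε u) (𝓝[>] 0)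
      (𝓝 (∫ u, (Metric.closedBall (0 : E) L).indicator Γ u)) := by
    refine tendsto_integral_filter_of_dominated_convergence G
      (Eventually.of_forall fun ε => (measurable_symTrunc hα L ε).aestronglyMeasurable) ?_ hG
      (Eventually.of_forall fun u => ?_)
    · filter_upwards [eventually_mem_Ioc_nhdsGT_zero] with ε hε
      refine Eventually.of_forall fun u => ?_
      rw [Real.norm_of_nonneg (symTrunc_nonneg _ _ _)]
      exact (symTrunc_le _ _ _).trans (hle e he ε hε.1 hε.2 u)
    · by_cases hu : u ∈ Metric.closedBall (0 : E) L
      · simp only [symTrunc, indicator_of_mem hu]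
        have h3 := (tendsto_exp_neg_powBregman (α := α) he u).min
          (tendsto_exp_neg_powBregman (α := α) he (-u))
        simpa [hΓ] using h3
      · simp only [symTrunc, indicator_of_notMem hu]
        exact tendsto_const_nhds
  exact h2.eventually_const_lt hL

end Integral

lemma integral_exp_neg_quadratic {n : ℕ} (i : Fin n) {α : ℝ} (hα : 1 < α) :
    ∫ u : EuclideanSpace ℝ (Fin n), exp (-(α / 2 * ‖u‖ ^ 2 +
      α * (α - 2) / 2 * (inner ℝ (EuclideanSpace.single i (1 : ℝ)) u) ^ 2)) =
      exp (-((log (α - 1) + n * log α - n * log (2 * π)) / 2)) := by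
  have hα0 : 0 < α := by linarith
  set b : Fin n → ℝ := fun j => if j = i then α * (α - 1) / 2 else α / 2 with hb
  have hbpos : ∀ j, 0 < b j := by
    intro j
    simp only [hb]
    split_ifs
    · have : 0 < α - 1 := by linarith
      positivity
    · positivity
  rw [← (PiLp.volume_preserving_toLp (Fin n)).integral_comp
    (MeasurableEquiv.toLp 2 (Fin n → ℝ)).measurableEmbedding]
  have h1 : ∀ x : Fin n → ℝ, exp (-(α / 2 * ‖WithLp.toLp 2 x‖ ^ 2 +
      α * (α - 2) / 2 * (inner ℝ (EuclideanSpace.single i (1 : ℝ)) (WithLp.toLp 2 x)) ^ 2)) =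
      ∏ j, exp (-b j * x j ^ 2) := by
    intro x
    rw [← exp_sum, EuclideanSpace.norm_sq_eq, EuclideanSpace.inner_single_left]
    congr 1
    have h2 : ∀ j, -b j * x j ^ 2 = -(α / 2 * x j ^ 2) +
        (if j = i then -(α * (α - 2) / 2 * x j ^ 2) else 0) := by
      intro j
      simp only [hb]
      split_ifs <;> ring
    simp_rw [h2]
    rw [Finset.sum_add_distrib, Finset.sum_ite_eq' Finset.univ i, Finset.sum_neg_distrib,
      ← Finset.mul_sum]
    simp
    ring
  simp_rw [h1]
  rw [integral_fintype_prod_volume_eq_prod (fun j (y : ℝ) => exp (-b j * y ^ 2))]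
  simp_rw [integral_gaussian]
  rw [← exp_log (Finset.prod_pos fun j _ => sqrt_pos.2 (div_pos pi_pos (hbpos j))),
    log_prod (fun j _ => (sqrt_pos.2 (div_pos pi_pos (hbpos j))).ne')]
  congr 1
  have h3 : ∀ j, log √(π / b j) = (log (2 * π) - log α) / 2 +
      (if j = i then -(log (α - 1) / 2) else 0) := by
    intro j
    rw [log_sqrt (div_pos pi_pos (hbpos j)).le, log_div pi_ne_zero (hbpos j).ne',
      log_mul two_ne_zero pi_ne_zero]
    simp only [hb]
    split_ifs
    · rw [log_div (mul_ne_zero hα0.ne' (by linarith)) two_ne_zero,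
        log_mul hα0.ne' (by linarith)]
      ring
    · rw [log_div hα0.ne' two_ne_zero]
      ring
  simp_rw [h3]
  rw [Finset.sum_add_distrib, Finset.sum_ite_eq' Finset.univ i]
  simp
  ring

end Laplace

section Convolution

/-- A nonnegative measurable integrable function bounded by `B`. -/
structure IsBddDensity {E : Type*} [MeasureSpace E] (f : E → ℝ) (B : ℝ) : Prop where
  measurable : Measurable f
  nonneg : ∀ x, 0 ≤ f x
  le : ∀ x, f x ≤ B
  integrable : Integrable f

section General

variable {E : Type*} [NormedAddCommGroup E] [InnerProductSpace ℝ E] [FiniteDimensional ℝ E]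
  [MeasurableSpace E] [BorelSpace E] {f p : E → ℝ} {A B : ℝ}

lemma IsBddDensity.integrable_mul (hf : IsBddDensity f B) (hp : IsBddDensity p A) (x : E) :
    Integrable fun y => f (x - y) * p y := by
  refine hp.integrable.bdd_mul (c := B) ?_ (Eventually.of_forall fun y => ?_)
  · exact (hf.measurable.comp (measurable_const.sub measurable_id)).aestronglyMeasurable
  · rw [Real.norm_eq_abs, abs_of_nonneg (hf.nonneg _)]
    exact hf.le _

lemma IsBddDensity.conv (hf : IsBddDensity f B) (hp : IsBddDensity p A) :
    IsBddDensity (fun x => ∫ y, f (x - y) * p y) (B * ∫ y, p y) ∧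
      ∫ x, ∫ y, f (x - y) * p y = (∫ x, f x) * ∫ y, p y := by
  have hcomm : (fun x => ∫ y, f (x - y) * p y) =
      convolution p f (ContinuousLinearMap.mul ℝ ℝ) volume := by
    ext x
    simp [convolution, mul_comm]
  refine ⟨⟨?_, fun x => ?_, fun x => ?_, ?_⟩, ?_⟩
  · refine (StronglyMeasurable.integral_prod_right ?_).measurable
    exact ((hf.measurable.comp (measurable_fst.sub measurable_snd)).mul
      (hp.measurable.comp measurable_snd)).stronglyMeasurable
  · exact integral_nonneg fun y => mul_nonneg (hf.nonneg _) (hp.nonneg _)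
  · rw [← integral_const_mul]
    exact integral_mono (hf.integrable_mul hp x) (hp.integrable.const_mul B)
      fun y => mul_le_mul_of_nonneg_right (hf.le _) (hp.nonneg _)
  · rw [hcomm]
    exact hp.integrable.integrable_convolution _ hf.integrable
  · rw [show (∫ x, ∫ y, f (x - y) * p y) = ∫ x, (fun x => ∫ y, f (x - y) * p y) x from rfl, hcomm,
      integral_convolution _ hp.integrable hf.integrable]
    simp [mul_comm]

/-- An `L¹`–`L²` bound for functions supported in a ball. -/
lemma IsBddDensity.sq_integral_le (hf : IsBddDensity f B) {R : ℝ} (hR : 0 < R)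
    (hsupp : ∀ x, R < ‖x‖ → f x = 0) :
    (∫ x, f x) ^ 2 / volume.real (Metric.closedBall (0 : E) R) ≤ ∫ x, f x * f x := by
  set V := volume.real (Metric.closedBall (0 : E) R) with hV
  have hVpos : 0 < V := by
    refine ENNReal.toReal_pos (Metric.measure_closedBall_pos _ _ hR).ne' ?_
    exact measure_closedBall_lt_top.ne
  set S := ∫ x, f x with hS
  have hind : Integrable ((Metric.closedBall (0 : E) R).indicator fun _ => (1 : ℝ)) :=
    (integrable_indicator_iff Metric.isClosed_closedBall.measurableSet).2
      (integrableOn_const measure_closedBall_lt_top.ne)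
  have hone : ∫ x, (Metric.closedBall (0 : E) R).indicator (fun _ => (1 : ℝ)) x = V := by
    rw [integral_indicator Metric.isClosed_closedBall.measurableSet]
    simp [hV, Measure.real]
  have hsq : Integrable fun x => f x * f x := by
    refine hf.integrable.bdd_mul (c := B) hf.measurable.aestronglyMeasurable
      (Eventually.of_forall fun y => ?_)
    rw [Real.norm_eq_abs, abs_of_nonneg (hf.nonneg _)]
    exact hf.le _
  have hle : ∫ x, (2 * (S / V) * f x -
      (S / V) ^ 2 * (Metric.closedBall (0 : E) R).indicator (fun _ => (1 : ℝ)) x) ≤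
      ∫ x, f x * f x := by
    refine integral_mono ((hf.integrable.const_mul _).sub (hind.const_mul _)) hsq fun x => ?_
    by_cases hx : x ∈ Metric.closedBall (0 : E) R
    · simp only [indicator_of_mem hx]
      nlinarith [sq_nonneg (f x - S / V)]
    · simp only [indicator_of_notMem hx]
      have : R < ‖x‖ := by simpa using hx
      simp [hsupp x this]
  rw [integral_sub (hf.integrable.const_mul _) (hind.const_mul _), integral_const_mul,
    integral_const_mul, hone] at hle
  refine le_trans (le_of_eq ?_) hle
  rw [← hS]
  field_simp
  ring

end General

variable {n : ℕ} {p q : EuclideanSpace ℝ (Fin n) → ℝ} {A B : ℝ}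

lemma IsBddDensity.convPow (hp : IsBddDensity p B) (m : ℕ) :
    IsBddDensity (convPow n p m) (B * (∫ y, p y) ^ m) ∧
      ∫ x, _root_.convPow n p m x = (∫ y, p y) ^ (m + 1) := by
  induction m with
  | zero => simpa [_root_.convPow] using hp
  | succ m ih =>
    have h := ih.1.conv hp
    refine ⟨?_, ?_⟩
    · rw [pow_succ, ← mul_assoc]
      exact h.1
    · rw [pow_succ, ← ih.2]
      exact h.2

lemma convPow_mono (hp : IsBddDensity p A) (hq : IsBddDensity q B) (hpq : ∀ x, p x ≤ q x)
    (m : ℕ) (x : EuclideanSpace ℝ (Fin n)) : convPow n p m x ≤ convPow n q m x := by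
  induction m generalizing x with
  | zero => exact hpq x
  | succ m ih =>
    exact integral_mono ((hp.convPow m).1.integrable_mul hp x)
      ((hq.convPow m).1.integrable_mul hq x) fun y =>
        mul_le_mul (ih _) (hpq y) (hp.nonneg y) ((hq.convPow m).1.nonneg _)

lemma convPow_comp_linearIsometryEquiv
    (R : EuclideanSpace ℝ (Fin n) ≃ₗᵢ[ℝ] EuclideanSpace ℝ (Fin n))
    (hR : ∀ x, p (R x) = p x) (m : ℕ) (x : EuclideanSpace ℝ (Fin n)) :
    convPow n p m (R x) = convPow n p m x := by
  induction m generalizing x with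
  | zero => exact hR x
  | succ m ih =>
    simp only [convPow]
    rw [← R.measurePreserving.integral_comp R.toHomeomorph.measurableEmbedding]
    simp_rw [← map_sub, ih, hR]

lemma convPow_neg (hp : ∀ x, p (-x) = p x) (m : ℕ) (x : EuclideanSpace ℝ (Fin n)) :
    convPow n p m (-x) = convPow n p m x :=
  convPow_comp_linearIsometryEquiv (LinearIsometryEquiv.neg ℝ) hp m x

lemma convPow_eq_zero {R : ℝ} (hp : ∀ x, R < ‖x‖ → p x = 0) (m : ℕ)
    (x : EuclideanSpace ℝ (Fin n)) (hx : (m + 1) * R < ‖x‖) : convPow n p m x = 0 := by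
  induction m generalizing x with
  | zero => exact hp x (by simpa using hx)
  | succ m ih =>
    refine integral_eq_zero_of_ae (Eventually.of_forall fun y => ?_)
    simp only [Pi.zero_apply]
    by_cases hy : R < ‖y‖
    · rw [hp y hy, mul_zero]
    · rw [ih, zero_mul]
      have := norm_sub_norm_le x y
      push_cast at hx
      linarith

lemma convPow_tilt (x b : EuclideanSpace ℝ (Fin n)) (a : ℝ) (m : ℕ)
    (w : EuclideanSpace ℝ (Fin n)) :
    convPow n (fun w => p (x + w) * exp (a + inner ℝ b w)) m w =
      convPow n p m ((m + 1 : ℝ) • x + w) * exp ((m + 1) * a + inner ℝ b w) := by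
  induction m generalizing w with
  | zero => simp [convPow]
  | succ m ih =>
    simp only [convPow, ih]
    rw [← integral_mul_const]
    conv_rhs => rw [← integral_add_left_eq_self _ x]
    refine integral_congr_ae (Eventually.of_forall fun y => ?_)
    simp only
    have h1 : ((m + 1 : ℕ) + 1 : ℝ) • x + w - (x + y) = (m + 1 : ℝ) • x + (w - y) := by
      push_cast
      module
    rw [h1, inner_sub_right]
    have h2 : exp (((m + 1 : ℕ) + 1 : ℝ) * a + inner ℝ b w) =
        exp ((m + 1) * a + (inner ℝ b w - inner ℝ b y)) * exp (a + inner ℝ b y) := by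
      rw [← exp_add]
      congr 1
      push_cast
      ring
    rw [h2]
    ring

lemma convPow_add (hp : IsBddDensity p B) (i j : ℕ) (x : EuclideanSpace ℝ (Fin n)) :
    convPow n p (i + j + 1) x = ∫ y, convPow n p i (x - y) * convPow n p j y := by
  induction j generalizing x with
  | zero => rfl
  | succ j ih =>
    have hi := (hp.convPow i).1
    have hj := (hp.convPow j).1
    have hinteg : Integrable (fun z : EuclideanSpace ℝ (Fin n) × EuclideanSpace ℝ (Fin n) =>
        convPow n p i (x - z.1) * (p z.2 * convPow n p j (z.1 - z.2))) (volume.prod volume) := by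
      refine (Integrable.convolution_integrand (ContinuousLinearMap.mul ℝ ℝ) hp.integrable
        hj.integrable).bdd_mul (c := B * (∫ y, p y) ^ i) ?_ (Eventually.of_forall fun z => ?_)
      · exact (hi.measurable.comp (measurable_const.sub measurable_fst)).aestronglyMeasurable
      · rw [Real.norm_eq_abs, abs_of_nonneg (hi.nonneg _)]
        exact hi.le _
    calc convPow n p (i + (j + 1) + 1) x
        = ∫ y, (∫ z, convPow n p i (x - y - z) * convPow n p j z) * p y := by
          simp_rw [← ih]
          rfl
      _ = ∫ y, ∫ z, convPow n p i (x - z) * (p y * convPow n p j (z - y)) := by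
          refine integral_congr_ae (Eventually.of_forall fun y => ?_)
          simp only
          rw [← integral_mul_const, ← integral_sub_right_eq_self _ y]
          refine integral_congr_ae (Eventually.of_forall fun z => ?_)
          simp only [sub_sub, add_sub_cancel]
          ring
      _ = ∫ z, ∫ y, convPow n p i (x - z) * (p y * convPow n p j (z - y)) :=
          integral_integral_swap hinteg.swap
      _ = ∫ z, convPow n p i (x - z) * convPow n p (j + 1) z := by
          refine integral_congr_ae (Eventually.of_forall fun z => ?_)
          simp only [convPow]
          rw [integral_const_mul]
          simp only [mul_comm]

lemma le_convPow_zero_of_even (hp : IsBddDensity p B) (hev : ∀ x, p (-x) = p x) {R : ℝ}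
    (hR : 0 < R) (hsupp : ∀ x, R < ‖x‖ → p x = 0) (k : ℕ) :
    (∫ x, p x) ^ (2 * (k + 1)) /
      volume.real (Metric.closedBall (0 : EuclideanSpace ℝ (Fin n)) ((k + 1) * R)) ≤
      convPow n p (2 * k + 1) 0 := by
  have hk := hp.convPow k
  have h := hk.1.sq_integral_le (R := (k + 1) * R) (by positivity)
    fun x hx => convPow_eq_zero hsupp k x hx
  rw [hk.2, ← pow_mul, mul_comm (k + 1) 2] at h
  refine h.trans (le_of_eq ?_)
  rw [two_mul, convPow_add hp]
  simp_rw [zero_sub, convPow_neg hev]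

end Convolution

section Weibull

section Jump

variable {E : Type*} [NormedAddCommGroup E] [InnerProductSpace ℝ E] {e : E} {α : ℝ}

/-- The Weibull-type jump density. -/
def weibullJump (α : ℝ) (z : E) : ℝ := exp (-‖z‖ ^ α)

/-- The density `weibullJump α`, recentred at `r • e` and exponentially tilted to be stationary
there. -/
def tiltedJump (α : ℝ) (e : E) (r : ℝ) (w : E) : ℝ :=
  exp (-(powBregman α e (r ^ (-(α / 2)) • ((r ^ (1 - α / 2))⁻¹ • w)) / (r ^ (-(α / 2))) ^ 2))

lemma powBregman_nonneg (hα : 1 < α) (he : ‖e‖ = 1) (v : E) : 0 ≤ powBregman α e v := by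
  obtain ⟨c, hc, h⟩ := exists_le_powBregman (E := E) hα
  rcases le_total ‖v‖ 1 with hv | hv
  · exact le_trans (by positivity) ((h e v he).1 hv)
  · exact le_trans (by positivity) ((h e v he).2 hv)

lemma weibullJump_tilt {r : ℝ} (hr : 0 < r) (w : E) :
    weibullJump α (r • e + w) * exp (r ^ α + inner ℝ ((α * r ^ (α - 1)) • e) w) =
      tiltedJump α e r w := by
  have h1 : r ^ (-(α / 2)) * (r ^ (1 - α / 2))⁻¹ = r⁻¹ := by
    rw [← rpow_neg hr.le, ← rpow_add hr, ← rpow_neg_one]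
    congr 1
    ring
  have h2 : (r ^ (-(α / 2))) ^ 2 = (r ^ α)⁻¹ := by
    rw [← rpow_natCast, ← rpow_mul hr.le, ← rpow_neg hr.le]
    congr 1
    push_cast
    ring
  have h3 : r • e + w = r • (e + r⁻¹ • w) := by
    rw [smul_add, smul_inv_smul₀ hr.ne']
  have h4 : r ^ (α - 1) = r ^ α * r⁻¹ := by rw [rpow_sub_one hr.ne', div_eq_mul_inv]
  rw [tiltedJump, smul_smul, h1, h2, weibullJump, ← exp_add, h3, norm_smul,
    Real.norm_of_nonneg hr.le, mul_rpow hr.le (norm_nonneg _), powBregman, real_inner_smul_left,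
    real_inner_smul_right, h4, div_inv_eq_mul]
  congr 1
  ring

lemma tiltedJump_eq (α : ℝ) (e : E) (r : ℝ) : tiltedJump α e r = fun w => (fun u : E =>
    exp (-(powBregman α e (r ^ (-(α / 2)) • u) / (r ^ (-(α / 2))) ^ 2)))
      ((r ^ (1 - α / 2))⁻¹ • w) := rfl

/-- A compactly supported even minorant of `tiltedJump`. -/
def tiltedTrunc (α : ℝ) (e : E) (L r : ℝ) (w : E) : ℝ :=
  symTrunc α e L (r ^ (-(α / 2))) ((r ^ (1 - α / 2))⁻¹ • w)

lemma tiltedTrunc_nonneg (L r : ℝ) (w : E) : 0 ≤ tiltedTrunc α e L r w :=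
  symTrunc_nonneg _ _ _

lemma tiltedTrunc_le (L r : ℝ) (w : E) : tiltedTrunc α e L r w ≤ tiltedJump α e r w :=
  symTrunc_le _ _ _

lemma tiltedTrunc_neg (L r : ℝ) (w : E) : tiltedTrunc α e L r (-w) = tiltedTrunc α e L r w := by
  rw [tiltedTrunc, smul_neg, symTrunc_neg, tiltedTrunc]

lemma tiltedTrunc_eq_zero {L r : ℝ} (hr : 0 < r) {w : E} (hw : L * r ^ (1 - α / 2) < ‖w‖) :
    tiltedTrunc α e L r w = 0 := by
  refine symTrunc_eq_zero ?_
  have : 0 < r ^ (1 - α / 2) := rpow_pos_of_pos hr _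
  rw [norm_smul, norm_inv, Real.norm_of_nonneg this.le, ← div_eq_inv_mul, lt_div_iff₀ this]
  exact hw

lemma rpow_neg_half_mem {r : ℝ} (hα : 1 < α) (hr : 1 ≤ r) :
    0 < r ^ (-(α / 2)) ∧ r ^ (-(α / 2)) ≤ 1 :=
  ⟨rpow_pos_of_pos (by linarith) _, rpow_le_one_of_one_le_of_nonpos hr (by linarith)⟩

variable [FiniteDimensional ℝ E] [MeasurableSpace E] [BorelSpace E]

lemma isBddDensity_weibullJump (hα : 1 < α) : IsBddDensity (weibullJump (E := E) α) 1 := by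
  have hm : Measurable (weibullJump (E := E) α) := by
    have : Continuous fun z : E => ‖z‖ ^ α :=
      continuous_norm.rpow_const fun _ => Or.inr (by linarith)
    unfold weibullJump
    fun_prop
  refine ⟨hm, fun x => (exp_pos _).le, fun x => ?_, ?_⟩
  · exact exp_le_one_iff.2 (neg_nonpos.2 (rpow_nonneg (norm_nonneg _) _))
  · refine ((integrable_exp_neg_mul_norm (E := E) (c := α) (by linarith)).const_mul
      (exp (α - 1))).mono' hm.aestronglyMeasurable (Eventually.of_forall fun x => ?_)
    rw [weibullJump, Real.norm_of_nonneg (exp_pos _).le, ← exp_add, exp_le_exp]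
    by_cases hx : ‖x‖ = 1
    · rw [hx, one_rpow]
      linarith
    · linarith [rpow_excess_pos hα (norm_nonneg x) hx]

lemma integrable_exp_neg_powBregman {ε : ℝ} (hα : 1 < α) (he : ‖e‖ = 1) (hε : 0 < ε)
    (hε1 : ε ≤ 1) : Integrable fun u : E => exp (-(powBregman α e (ε • u) / ε ^ 2)) := by
  obtain ⟨G, hG, hle⟩ := exists_integrable_bound (E := E) hα
  refine hG.mono' (continuous_exp_neg_powBregman hα ε).aestronglyMeasurable
    (Eventually.of_forall fun u => ?_)
  rw [Real.norm_of_nonneg (exp_pos _).le]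
  exact hle e he ε hε hε1 u

lemma isBddDensity_tiltedJump {r : ℝ} (hα : 1 < α) (he : ‖e‖ = 1) (hr : 1 ≤ r) :
    IsBddDensity (tiltedJump α e r) 1 := by
  obtain ⟨h1, h2⟩ := rpow_neg_half_mem hα hr
  refine ⟨?_, fun x => (exp_pos _).le, fun x => ?_, ?_⟩
  · rw [tiltedJump_eq]
    exact ((continuous_exp_neg_powBregman hα _).comp (continuous_const_smul _)).measurable
  · exact exp_le_one_iff.2 (neg_nonpos.2 (div_nonneg (powBregman_nonneg hα he _) (sq_nonneg _)))
  · rw [tiltedJump_eq]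
    exact (integrable_exp_neg_powBregman hα he h1 h2).comp_smul
      (inv_ne_zero (rpow_pos_of_pos (by linarith) _).ne')

lemma integral_tiltedJump {r : ℝ} (hr : 0 < r) :
    ∫ w, tiltedJump α e r w = (r ^ (1 - α / 2)) ^ Module.finrank ℝ E *
      ∫ u : E, exp (-(powBregman α e (r ^ (-(α / 2)) • u) / (r ^ (-(α / 2))) ^ 2)) := by
  rw [tiltedJump_eq, Measure.integral_comp_inv_smul_of_nonneg _ _ (rpow_nonneg hr.le _),
    smul_eq_mul]

lemma integral_exp_neg_powBregman_pos {ε : ℝ} (hα : 1 < α) (he : ‖e‖ = 1) (hε : 0 < ε)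
    (hε1 : ε ≤ 1) : 0 < ∫ u : E, exp (-(powBregman α e (ε • u) / ε ^ 2)) :=
  integral_exp_pos (integrable_exp_neg_powBregman hα he hε hε1)

lemma isBddDensity_tiltedTrunc {L r : ℝ} (hα : 1 < α) (he : ‖e‖ = 1) (hr : 1 ≤ r) :
    IsBddDensity (tiltedTrunc α e L r) 1 := by
  have hP := isBddDensity_tiltedJump hα he hr
  have hm : Measurable (tiltedTrunc α e L r) :=
    (measurable_symTrunc hα L _).comp (measurable_const_smul _)
  refine ⟨hm, tiltedTrunc_nonneg L r, fun x => (tiltedTrunc_le L r x).trans (hP.le x),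
    hP.integrable.mono' hm.aestronglyMeasurable (Eventually.of_forall fun x => ?_)⟩
  rw [Real.norm_of_nonneg (tiltedTrunc_nonneg L r x)]
  exact tiltedTrunc_le L r x

lemma integral_tiltedTrunc {L r : ℝ} (hr : 0 < r) :
    ∫ w, tiltedTrunc α e L r w = (r ^ (1 - α / 2)) ^ Module.finrank ℝ E *
      ∫ u : E, symTrunc α e L (r ^ (-(α / 2))) u := by
  unfold tiltedTrunc
  rw [Measure.integral_comp_inv_smul_of_nonneg _ _ (rpow_nonneg hr.le _), smul_eq_mul]

end Jump

variable {n : ℕ} {e : EuclideanSpace ℝ (Fin n)} {α : ℝ}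

lemma weibullCPDensity_eq (t : ℝ) (y : EuclideanSpace ℝ (Fin n)) :
    weibullCPDensity n α t y =
      exp (-(∫ z : EuclideanSpace ℝ (Fin n), weibullJump α z) * t) *
        ∑' m : ℕ, t ^ (m + 1) / (Nat.factorial (m + 1) : ℝ) * convPow n (weibullJump α) m y := rfl

lemma weibullCPDensity_eq_of_norm_eq (t : ℝ) {y z : EuclideanSpace ℝ (Fin n)}
    (h : ‖y‖ = ‖z‖) : weibullCPDensity n α t y = weibullCPDensity n α t z := by
  have hc : ∀ m, convPow n (weibullJump α) m y = convPow n (weibullJump α) m z := by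
    intro m
    rw [← Submodule.reflection_sub h]
    exact (convPow_comp_linearIsometryEquiv _
      (fun x => by simp only [weibullJump, LinearIsometryEquiv.norm_map]) m y).symm
  simp only [weibullCPDensity_eq, hc]

lemma convPow_tiltedJump {r : ℝ} (hr : 0 < r) (m : ℕ) (w : EuclideanSpace ℝ (Fin n)) :
    convPow n (tiltedJump α e r) m w = convPow n (weibullJump α) m ((m + 1 : ℝ) • r • e + w) *
      exp ((m + 1) * r ^ α + inner ℝ ((α * r ^ (α - 1)) • e) w) := by
  rw [← convPow_tilt]
  simp_rw [weibullJump_tilt hr]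

lemma convPow_weibullJump_smul_le (hα : 1 < α) (he : ‖e‖ = 1) {r : ℝ} (hr : 1 ≤ r) (N : ℝ)
    (m : ℕ) : convPow n (weibullJump α) m (N • e) ≤ (∫ w, tiltedJump α e r w) ^ m *
      exp ((m + 1) * ((α - 1) * r ^ α)) * exp (-(α * r ^ (α - 1) * N)) := by
  have hr0 : 0 < r := by linarith
  have h1 := ((isBddDensity_tiltedJump hα he hr).convPow m).1.le
    (N • e - (m + 1 : ℝ) • r • e)
  rw [convPow_tiltedJump hr0, one_mul, add_sub_cancel, ← le_div_iff₀ (exp_pos _)] at h1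
  refine h1.trans (le_of_eq ?_)
  rw [div_eq_mul_inv, ← exp_neg, mul_assoc, ← exp_add]
  congr 2
  rw [smul_smul, ← sub_smul, real_inner_smul_left, real_inner_smul_right,
    real_inner_self_eq_norm_sq, he]
  have h4 : r ^ α = r ^ (α - 1) * r := by rw [← rpow_add_one hr0.ne', sub_add_cancel]
  rw [h4]
  ring

lemma hasSum_pow_succ_div_factorial (x : ℝ) :
    HasSum (fun m : ℕ => x ^ (m + 1) / (Nat.factorial (m + 1) : ℝ)) (exp x - 1) := by
  have h : HasSum (fun m : ℕ => x ^ m / (Nat.factorial m : ℝ)) (exp x) := by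
    rw [Real.exp_eq_exp_ℝ]
    exact NormedSpace.expSeries_div_hasSum_exp x
  simpa using (hasSum_nat_add_iff' 1).2 h

/-- The exponential Chebyshev bound for the compound Poisson series. -/
lemma weibullCPDensity_summable_and_le (hα : 1 < α) (he : ‖e‖ = 1) {r : ℝ} (hr : 1 ≤ r) (N : ℝ)
    {t : ℝ} (ht : 0 < t) :
    (Summable fun m : ℕ => t ^ (m + 1) / (Nat.factorial (m + 1) : ℝ) *
      convPow n (weibullJump α) m (N • e)) ∧
    weibullCPDensity n α t (N • e) ≤ (∫ w, tiltedJump α e r w)⁻¹ *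
      exp (-(α * r ^ (α - 1) * N)) *
        exp (t * (∫ w, tiltedJump α e r w) * exp ((α - 1) * r ^ α)) := by
  set S := ∫ w, tiltedJump α e r w with hS
  have hSpos : 0 < S := by
    obtain ⟨h1, h2⟩ := rpow_neg_half_mem hα hr
    rw [hS, integral_tiltedJump (by linarith)]
    exact mul_pos (pow_pos (rpow_pos_of_pos (by linarith) _) _)
      (integral_exp_neg_powBregman_pos hα he h1 h2)
  set x := t * S * exp ((α - 1) * r ^ α) with hx
  set T := exp (-(α * r ^ (α - 1) * N)) with hT
  have hsum := (hasSum_pow_succ_div_factorial x).mul_left (S⁻¹ * T)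
  have hnn : ∀ m : ℕ, 0 ≤ t ^ (m + 1) / (Nat.factorial (m + 1) : ℝ) *
      convPow n (weibullJump α) m (N • e) := fun m =>
    mul_nonneg (by positivity) (((isBddDensity_weibullJump hα).convPow m).1.nonneg _)
  have hle : ∀ m : ℕ, t ^ (m + 1) / (Nat.factorial (m + 1) : ℝ) *
      convPow n (weibullJump α) m (N • e) ≤
      S⁻¹ * T * (x ^ (m + 1) / (Nat.factorial (m + 1) : ℝ)) := by
    intro m
    refine (mul_le_mul_of_nonneg_left (convPow_weibullJump_smul_le hα he hr N m)
      (by positivity)).trans (le_of_eq ?_)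
    rw [← hS, ← hT, hx, mul_pow, mul_pow, ← exp_nat_mul, pow_succ S]
    push_cast
    field_simp
  have hs := hsum.summable.of_nonneg_of_le hnn hle
  refine ⟨hs, ?_⟩
  rw [weibullCPDensity_eq]
  have h1 : exp (-(∫ z : EuclideanSpace ℝ (Fin n), weibullJump α z) * t) ≤ 1 := by
    refine exp_le_one_iff.2 ?_
    have : 0 ≤ ∫ z : EuclideanSpace ℝ (Fin n), weibullJump α z :=
      integral_nonneg fun z => (exp_pos _).le
    nlinarith
  refine (mul_le_of_le_one_left (tsum_nonneg hnn) h1).trans ?_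
  refine (hs.tsum_le_tsum hle hsum.summable).trans ?_
  rw [hsum.tsum_eq]
  refine mul_le_mul_of_nonneg_left (by linarith) (by positivity)

lemma weibullCPDensity_pos (hα : 1 < α) (he : ‖e‖ = 1) (N : ℝ) {t : ℝ} (ht : 0 < t) :
    0 < weibullCPDensity n α t (N • e) := by
  rw [weibullCPDensity_eq]
  have h := (weibullCPDensity_summable_and_le hα he le_rfl N ht).1.le_tsum 0 fun j _ =>
    mul_nonneg (by positivity) (((isBddDensity_weibullJump hα).convPow j).1.nonneg _)
  refine mul_pos (exp_pos _) (lt_of_lt_of_le ?_ h)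
  exact mul_pos (by positivity) (exp_pos _)

lemma log_factorial_le (m : ℕ) : log (Nat.factorial (m + 1) : ℝ) ≤
    1 + log (m + 1 : ℕ) + (m + 1 : ℕ) * log (m + 1 : ℕ) - (m + 1 : ℕ) := by
  induction m with
  | zero => simp
  | succ m ih =>
    rw [Nat.factorial_succ, Nat.cast_mul, log_mul (by positivity) (by positivity)]
    have h1 := log_le_sub_one_of_pos (x := (m + 1 : ℝ) / (m + 2)) (by positivity)
    rw [log_div (by positivity) (by positivity)] at h1
    have h2 : (m + 2 : ℝ) * (log (m + 1) - log (m + 2)) ≤ -1 := by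
      refine (mul_le_mul_of_nonneg_left h1 (by positivity)).trans (le_of_eq ?_)
      field_simp
      ring
    push_cast at ih ⊢
    rw [show (m + 1 + 1 : ℝ) = m + 2 by ring]
    linarith

lemma le_convPow_weibullJump_smul (hα : 1 < α) (he : ‖e‖ = 1) {r L : ℝ} (hr : 1 ≤ r)
    (hL : 0 < L) (k : ℕ) :
    (∫ w, tiltedTrunc α e L r w) ^ (2 * (k + 1)) /
      volume.real (Metric.closedBall (0 : EuclideanSpace ℝ (Fin n))
        ((k + 1) * (L * r ^ (1 - α / 2)))) * exp (-(2 * (k + 1) * r ^ α)) ≤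
      convPow n (weibullJump α) (2 * k + 1) ((2 * (k + 1) * r) • e) := by
  have hr0 : 0 < r := by linarith
  have hf := isBddDensity_tiltedTrunc (L := L) hα he hr
  have h1 := le_convPow_zero_of_even hf (tiltedTrunc_neg L r)
    (mul_pos hL (rpow_pos_of_pos hr0 _)) (fun x hx => tiltedTrunc_eq_zero hr0 hx) k
  have h2 := h1.trans
    (convPow_mono hf (isBddDensity_tiltedJump hα he hr) (tiltedTrunc_le L r) (2 * k + 1) 0)
  rw [convPow_tiltedJump hr0] at h2
  rw [exp_neg, ← div_eq_mul_inv, div_le_iff₀ (exp_pos _)]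
  refine h2.trans (le_of_eq ?_)
  rw [add_zero, inner_zero_right, add_zero, smul_smul]
  push_cast
  ring_nf

/-- The lower bound for the compound Poisson series coming from a single even term. -/
lemma le_log_weibullCPDensity (hα : 1 < α) (he : ‖e‖ = 1) {r L : ℝ} (hr : 1 ≤ r)
    (hL : 0 < L) (k : ℕ) {t : ℝ} (ht : 0 < t)
    (hI : 0 < ∫ u : EuclideanSpace ℝ (Fin n), symTrunc α e L (r ^ (-(α / 2))) u) :
    -(∫ z : EuclideanSpace ℝ (Fin n), weibullJump α z) * t +
      (2 * (k + 1)) * (log t - log (2 * (k + 1)) + 1 - r ^ α + n * ((1 - α / 2) * log r) +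
        log (∫ u : EuclideanSpace ℝ (Fin n), symTrunc α e L (r ^ (-(α / 2))) u)) -
      (1 + log (2 * (k + 1)) + n * log ((k + 1) * (L * r ^ (1 - α / 2))) +
        log (volume.real (Metric.ball (0 : EuclideanSpace ℝ (Fin n)) 1))) ≤
      log (weibullCPDensity n α t ((2 * (k + 1) * r) • e)) := by
  have hr0 : 0 < r := by linarith
  set I := ∫ u : EuclideanSpace ℝ (Fin n), symTrunc α e L (r ^ (-(α / 2))) u with hIdef
  set V := volume.real (Metric.ball (0 : EuclideanSpace ℝ (Fin n)) 1) with hV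
  have hVpos : 0 < V :=
    ENNReal.toReal_pos (Metric.measure_ball_pos _ _ one_pos).ne' measure_ball_lt_top.ne
  have hσ : 0 < r ^ (1 - α / 2) := rpow_pos_of_pos hr0 _
  have h1 := le_convPow_weibullJump_smul hα he hr hL k
  rw [Measure.addHaar_real_closedBall _ _ (by positivity), integral_tiltedTrunc hr0, ← hIdef,
    finrank_euclideanSpace, Fintype.card_fin, ← hV] at h1
  have hnn : ∀ m : ℕ, 0 ≤ t ^ (m + 1) / (Nat.factorial (m + 1) : ℝ) *
      convPow n (weibullJump α) m ((2 * (k + 1) * r) • e) := fun m =>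
    mul_nonneg (by positivity) (((isBddDensity_weibullJump hα).convPow m).1.nonneg _)
  have h2 := (weibullCPDensity_summable_and_le hα he le_rfl (2 * (k + 1) * r) ht).1.le_tsum
    (2 * k + 1) fun j _ => hnn j
  have h3 : exp (-(∫ z : EuclideanSpace ℝ (Fin n), weibullJump α z) * t) *
      (t ^ (2 * k + 1 + 1) / (Nat.factorial (2 * k + 1 + 1) : ℝ) *
        (((r ^ (1 - α / 2)) ^ n * I) ^ (2 * (k + 1)) /
          (((k + 1) * (L * r ^ (1 - α / 2))) ^ n * V) * exp (-(2 * (k + 1) * r ^ α)))) ≤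
      weibullCPDensity n α t ((2 * (k + 1) * r) • e) := by
    rw [weibullCPDensity_eq]
    refine mul_le_mul_of_nonneg_left (le_trans ?_ h2) (exp_pos _).le
    exact mul_le_mul_of_nonneg_left h1 (by positivity)
  have h4 := log_factorial_le (2 * k + 1)
  have h5 := log_le_log (by positivity) h3
  rw [log_mul (exp_pos _).ne' (by positivity), log_exp, log_mul (by positivity) (by positivity),
    log_div (by positivity) (by positivity), log_mul (by positivity) (by positivity), log_exp,
    log_div (by positivity) (by positivity), log_pow, log_pow,
    log_mul (by positivity) hI.ne', log_mul (by positivity) hVpos.ne', log_pow, log_pow,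
    log_rpow hr0] at h5
  push_cast at h4 h5
  rw [show (2 * k + 1 + 1 : ℝ) = 2 * (k + 1) by ring] at h4 h5
  linarith

end Weibull

section Assembly

variable {n : ℕ} {e : EuclideanSpace ℝ (Fin n)} {α : ℝ}

lemma log_weibullCPDensity_le (hα : 1 < α) (he : ‖e‖ = 1) {G N t δ K J : ℝ} (hG : 1 ≤ G)
    (hN : 0 < N) (ht : 0 < t)
    (hJ : J = ∫ u : EuclideanSpace ℝ (Fin n),
      exp (-(powBregman α e (G ^ (-(α / 2)) • u) / (G ^ (-(α / 2))) ^ 2)))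
    (heq : (α - 1) * G ^ α + (1 + n * (1 - α / 2)) * log G = K + log (N / t))
    (hJK : J * exp K ≤ 1 + δ / 2)
    (herr : -(n * (1 - α / 2) * log G) - log J ≤ δ / 2 * (N * G⁻¹)) :
    log (weibullCPDensity n α t (N • e)) ≤ -N * (α * G ^ (α - 1) - (1 + δ) * G⁻¹) := by
  have hG0 : 0 < G := by linarith
  have hJpos : 0 < J := by
    obtain ⟨h1, h2⟩ := rpow_neg_half_mem hα hG
    rw [hJ]
    exact integral_exp_neg_powBregman_pos hα he h1 h2
  have h1 := log_le_log (weibullCPDensity_pos hα he N ht)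
    (weibullCPDensity_summable_and_le hα he hG N ht).2
  rw [integral_tiltedJump hG0, ← hJ, finrank_euclideanSpace, Fintype.card_fin] at h1
  have hσ : 0 < G ^ (1 - α / 2) := rpow_pos_of_pos hG0 _
  rw [log_mul (by positivity) (by positivity), log_mul (by positivity) (by positivity), log_inv,
    log_exp, log_exp, log_mul (by positivity) hJpos.ne', log_pow, log_rpow hG0] at h1
  have h2 : t * ((G ^ (1 - α / 2)) ^ n * J) * exp ((α - 1) * G ^ α) = N * G⁻¹ * (J * exp K) := by
    have h3 : (α - 1) * G ^ α = K + log N - log t - log G - n * ((1 - α / 2) * log G) := by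
      rw [log_div hN.ne' ht.ne'] at heq
      linarith
    have h4 : (G ^ (1 - α / 2)) ^ n = exp (n * ((1 - α / 2) * log G)) := by
      rw [exp_nat_mul, rpow_def_of_pos hG0, mul_comm (log G)]
    rw [h3, h4, exp_sub, exp_sub, exp_sub, exp_add, exp_log hN, exp_log ht, exp_log hG0]
    field_simp
  rw [h2] at h1
  have h3 := mul_le_mul_of_nonneg_left hJK (by positivity : 0 ≤ N * G⁻¹)
  linarith

lemma le_log_weibullCPDensity_of_eq (hα : 1 < α) (he : ‖e‖ = 1)
    {G N t δ η K L R : ℝ} (hR : 1 ≤ R) (hGR : 3 * R ≤ G) (hNG : G ≤ N) (ht : 0 < t) (hL : 0 < L)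
    (hη : η ≤ 1)
    (hI : ∀ r, R ≤ r → exp (-K - η) ≤
      ∫ u : EuclideanSpace ℝ (Fin n), symTrunc α e L (r ^ (-(α / 2))) u)
    (heq : (α - 1) * G ^ α + (1 + n * (1 - α / 2)) * log G = K + log (N / t))
    (herr : (∫ z : EuclideanSpace ℝ (Fin n), weibullJump α z) * t + 2 * (α - 1) * G ^ α +
      6 * |1 + n * (1 - α / 2)| + 1 + (n + 1) * log N + n * |log L| + n * (|1 - α / 2| * log G) +
      log (volume.real (Metric.ball (0 : EuclideanSpace ℝ (Fin n)) 1)) ≤ (δ - η) * (N * G⁻¹)) :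
    -N * (α * G ^ (α - 1) - (1 - δ) * G⁻¹) ≤ log (weibullCPDensity n α t (N • e)) := by
  have hG0 : 0 < G := by linarith
  have hN : 0 < N := by linarith
  obtain ⟨k, hk1, hk2⟩ : ∃ k : ℕ, N / G < 2 * (k + 1) ∧ 2 * (k + 1) ≤ N / G + 2 := by
    refine ⟨⌊N / (2 * G)⌋₊, ?_, ?_⟩
    · have := Nat.lt_floor_add_one (N / (2 * G))
      rw [show N / G = 2 * (N / (2 * G)) by field_simp]
      linarith
    · have := Nat.floor_le (a := N / (2 * G)) (by positivity)
      rw [show N / G = 2 * (N / (2 * G)) by field_simp]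
      linarith
  set M : ℝ := 2 * (k + 1) with hM
  have hMpos : 0 < M := by positivity
  set r := N / M with hr
  have hMr : M * r = N := mul_div_cancel₀ _ hMpos.ne'
  have hrG : r ≤ G := by
    rw [div_lt_iff₀ hG0] at hk1
    rw [hr, div_le_iff₀ hMpos]
    linarith
  have hMG : M * G ≤ N + 2 * G := by
    have := mul_le_mul_of_nonneg_right hk2 hG0.le
    rwa [add_mul, div_mul_cancel₀ _ hG0.ne'] at this
  have hRr : R ≤ r := by
    rw [hr, le_div_iff₀ hMpos]
    nlinarith
  have hr1 : 1 ≤ r := hR.trans hRr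
  have hr0 : 0 < r := by linarith
  have hI' := hI r hRr
  have hIpos := (exp_pos _).trans_le hI'
  have h1 := le_log_weibullCPDensity hα he hr1 hL k ht hIpos
  rw [← hM, hMr] at h1
  refine le_trans ?_ h1
  have hlogI := log_le_log (exp_pos _) hI'
  rw [log_exp] at hlogI
  set I := ∫ u : EuclideanSpace ℝ (Fin n), symTrunc α e L (r ^ (-(α / 2))) u
  have hlogM : log M + log r = log N := by rw [← log_mul hMpos.ne' hr0.ne', hMr]
  have hlogr : 0 ≤ log r := log_nonneg hr1
  have hlogrG : log r ≤ log G := log_le_log hr0 hrG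
  have hvol : log ((k + 1) * (L * r ^ (1 - α / 2))) ≤
      log N + |log L| + |1 - α / 2| * log G := by
    rw [show (k + 1 : ℝ) = M / 2 by rw [hM]; ring, log_mul (by positivity) (by positivity),
      log_mul hL.ne' (by positivity), log_div hMpos.ne' (by norm_num), log_rpow hr0]
    have h2 : (1 - α / 2) * log r ≤ |1 - α / 2| * log G :=
      mul_le_mul (le_abs_self _) hlogrG hlogr (abs_nonneg _)
    have h3 : 0 ≤ log 2 := log_nonneg (by norm_num)
    linarith [le_abs_self (log L)]
  have hvol' := mul_le_mul_of_nonneg_left hvol (Nat.cast_nonneg (α := ℝ) n)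
  have hrα : M * r ^ α ≤ N * G ^ (α - 1) := by
    have h2 : r ^ α = r ^ (α - 1) * r := by rw [← rpow_add_one hr0.ne', sub_add_cancel]
    rw [h2, mul_comm _ r, ← mul_assoc, hMr]
    exact mul_le_mul_of_nonneg_left (rpow_le_rpow hr0.le hrG (by linarith)) hN.le
  have hGα : M * ((α - 1) * G ^ α) ≤ (α - 1) * N * G ^ (α - 1) + 2 * (α - 1) * G ^ α := by
    have h2 : G ^ α = G * G ^ (α - 1) := by
      rw [mul_comm, ← rpow_add_one hG0.ne', sub_add_cancel]
    have h3 := mul_le_mul_of_nonneg_right hMG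
      (mul_nonneg (sub_nonneg.2 hα.le) (rpow_nonneg hG0.le (α - 1)))
    rw [h2]
    linarith
  have hlog : M * (log G - log r) ≤ 6 := by
    have h2 := log_le_sub_one_of_pos (x := G / r) (by positivity)
    rw [log_div hG0.ne' hr0.ne'] at h2
    have h3 : G / r - 1 ≤ 2 * G / N := by
      rw [hr, div_div_eq_mul_div, sub_le_iff_le_add, div_le_iff₀ hN, add_mul,
        div_mul_cancel₀ _ hN.ne']
      linarith
    refine (mul_le_mul_of_nonneg_left (h2.trans h3) hMpos.le).trans ?_
    rw [← mul_div_assoc, div_le_iff₀ hN]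
    linarith
  have hc : M * ((1 + n * (1 - α / 2)) * (log G - log r)) ≤ 6 * |1 + n * (1 - α / 2)| := by
    have h2 : (1 + n * (1 - α / 2)) * (M * (log G - log r)) ≤ |1 + n * (1 - α / 2)| * 6 :=
      mul_le_mul (le_abs_self _) hlog (mul_nonneg hMpos.le (sub_nonneg.2 hlogrG)) (abs_nonneg _)
    linarith
  have hmain : (1 - η) * (N * G⁻¹) ≤ M * (1 + K + log I) := by
    rw [← div_eq_mul_inv]
    calc (1 - η) * (N / G) ≤ (1 - η) * M :=
          mul_le_mul_of_nonneg_left hk1.le (by linarith)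
      _ ≤ (1 + K + log I) * M := mul_le_mul_of_nonneg_right (by linarith) hMpos.le
      _ = _ := mul_comm _ _
  have hbr : log t - log M + 1 - r ^ α + n * ((1 - α / 2) * log r) + log I =
      (1 + K + log I) - r ^ α - (α - 1) * G ^ α -
        (1 + n * (1 - α / 2)) * (log G - log r) := by
    rw [log_div hN.ne' ht.ne'] at heq
    linear_combination heq - hlogM
  rw [hbr, mul_sub, mul_sub, mul_sub]
  linarith

lemma eventually_mul_log_le (γ A B : ℝ) (hγ : γ < 1) (hA : 0 ≤ A) (hB : 0 ≤ B) :
    ∀ᶠ N : ℝ in atTop, A * (N ^ γ + B * log N + 1) * (B * log N) ≤ N := by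
  set γ' := max γ (1 / 2) with hγ'
  have h0 : 0 < γ' := lt_of_lt_of_le (by norm_num) (le_max_right _ _)
  have h1 : 0 < 1 - γ' := sub_pos.2 (max_lt hγ (by norm_num))
  set D := A * (2 + B) * B with hD
  have hD0 : 0 ≤ D := by positivity
  filter_upwards [(isLittleO_log_rpow_atTop h0).bound (zero_lt_one),
    (isLittleO_log_rpow_atTop h1).bound (c := (D + 1)⁻¹) (by positivity),
    eventually_ge_atTop 1] with N hN1 hN2 hN
  have hN0 : 0 < N := by linarith
  have hlog := log_nonneg hN
  rw [Real.norm_of_nonneg hlog, Real.norm_of_nonneg (rpow_nonneg hN0.le _)] at hN1 hN2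
  rw [one_mul] at hN1
  have h2 : N ^ γ ≤ N ^ γ' := rpow_le_rpow_of_exponent_le hN (le_max_left _ _)
  have h3 : 1 ≤ N ^ γ' := one_le_rpow hN h0.le
  have h4 : N ^ γ + B * log N + 1 ≤ (2 + B) * N ^ γ' := by
    have := mul_le_mul_of_nonneg_left hN1 hB
    linarith
  have h5 : D * log N ≤ N ^ (1 - γ') := by
    rw [← div_eq_inv_mul, le_div_iff₀ (by positivity)] at hN2
    linarith
  calc A * (N ^ γ + B * log N + 1) * (B * log N)
      ≤ A * ((2 + B) * N ^ γ') * (B * log N) := by gcongr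
    _ = N ^ γ' * (D * log N) := by rw [hD]; ring
    _ ≤ N ^ γ' * N ^ (1 - γ') := by gcongr
    _ = N := by rw [← rpow_add hN0, add_sub_cancel, rpow_one]

lemma exp_add_linear_of_rpow_add_log {c₁ c₂ c₃ Λ₀ : ℝ} {g : ℝ → ℝ} (hΛ₀ : 0 < Λ₀)
    (hg1 : ∀ Λ, Λ₀ < Λ → 1 < g Λ)
    (hg : ∀ Λ, Λ₀ < Λ → g Λ ^ α + c₁ * log (g Λ) = c₂ + c₃ * log Λ) :
    (∀ x, log Λ₀ < x → 0 < log (g (exp x))) ∧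
    (∀ x, log Λ₀ < x → exp (α * log (g (exp x))) + c₁ * log (g (exp x)) = c₂ + c₃ * x) ∧
    ∀ x, log Λ₀ < x → g (exp x) = exp (log (g (exp x))) := by
  have h : ∀ x, log Λ₀ < x → Λ₀ < exp x := fun x hx => (log_lt_iff_lt_exp hΛ₀).1 hx
  refine ⟨fun x hx => log_pos (hg1 _ (h x hx)), fun x hx => ?_, fun x hx => ?_⟩
  · have h1 := hg _ (h x hx)
    rwa [log_exp, rpow_def_of_pos (by linarith [hg1 _ (h x hx)]), mul_comm (log _) α] at h1
  · rw [exp_log (by linarith [hg1 _ (h x hx)])]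

lemma eventually_forall_mem_Icc_of_rpow_add_log (hα : 1 < α) {c₁ c₂ c₃ Λ₀ : ℝ} {g : ℝ → ℝ}
    (hc₃ : 0 < c₃) (hΛ₀ : 0 < Λ₀) (hg1 : ∀ Λ, Λ₀ < Λ → 1 < g Λ)
    (hg : ∀ Λ, Λ₀ < Λ → g Λ ^ α + c₁ * log (g Λ) = c₂ + c₃ * log Λ)
    {ρ γ : ℝ} (hργ : ρ < γ) (hγ : γ < 1) {A : ℝ} (hA : 0 ≤ A) (R : ℝ) :
    ∀ᶠ N : ℝ in atTop, ∀ t ∈ Icc (N ^ ρ) (N ^ γ), 0 < t ∧ Λ₀ < N / t ∧ R ≤ g (N / t) ∧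
      A * (t + g (N / t) ^ α + log N + 1) * g (N / t) ≤ N := by
  obtain ⟨hk0, hk, hgk⟩ := exp_add_linear_of_rpow_add_log hΛ₀ hg1 hg
  obtain ⟨C, hC, hle⟩ := exists_eventually_exp_le_of_exp_add_linear hα hc₃ hk0 hk
  have ht := tendsto_atTop_of_exp_add_linear hα hc₃ hk0 hk
  obtain ⟨X, hX⟩ := eventually_atTop.1 ((eventually_gt_atTop (log Λ₀)).and
    (hle.and ((tendsto_exp_atTop.comp ht).eventually_ge_atTop R)))
  set B := C * (1 - ρ) + 1 with hB
  have hρ : 0 < 1 - ρ := by linarith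
  have hB0 : 0 ≤ B := by positivity
  filter_upwards [eventually_mul_log_le γ A B hγ hA hB0, eventually_ge_atTop 1,
    (tendsto_log_atTop.const_mul_atTop (sub_pos.2 hγ)).eventually_ge_atTop X] with N hN hN1 hNX
  rintro t ⟨ht1, ht2⟩
  have hN0 : 0 < N := by linarith
  have ht0 : 0 < t := (rpow_pos_of_pos hN0 _).trans_le ht1
  have hlt1 := log_le_log (rpow_pos_of_pos hN0 _) ht1
  have hlt2 := log_le_log ht0 ht2
  rw [log_rpow hN0] at hlt1 hlt2
  have hx : log (N / t) = log N - log t := log_div hN0.ne' ht0.ne'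
  obtain ⟨h1, h2, h3⟩ := hX (log (N / t)) (by linarith)
  have hlogN := log_nonneg hN1
  simp only [Function.comp_apply, exp_log (div_pos hN0 ht0)] at h2 h3
  have hΛ : Λ₀ < N / t := (log_lt_log_iff hΛ₀ (div_pos hN0 ht0)).1 h1
  have hG1 := hg1 _ hΛ
  set G := g (N / t) with hG
  have hG0 : 0 < G := by linarith
  rw [exp_log hG0] at h3
  rw [mul_comm α, ← rpow_def_of_pos hG0] at h2
  have h4 : G ^ α ≤ C * (1 - ρ) * log N := by
    rw [mul_assoc]
    exact h2.trans (mul_le_mul_of_nonneg_left (by linarith) hC.le)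
  have h5 : G ≤ G ^ α := self_le_rpow_of_one_le hG1.le hα.le
  refine ⟨ht0, hΛ, h3, le_trans ?_ hN⟩
  have h6 : G ≤ B * log N := by linarith
  have h7 : t + G ^ α + log N + 1 ≤ N ^ γ + B * log N + 1 := by linarith
  have h8 : 0 ≤ t + G ^ α + log N + 1 := by positivity
  exact mul_le_mul (mul_le_mul_of_nonneg_left h7 hA) h6 hG0.le
    (mul_nonneg hA (h8.trans h7))

lemma tendsto_slowlyVarying_of_rpow_add_log (hα : 1 < α) {c₁ c₂ c₃ Λ₀ : ℝ} {g : ℝ → ℝ}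
    (hc₃ : 0 < c₃) (hΛ₀ : 0 < Λ₀) (hg1 : ∀ Λ, Λ₀ < Λ → 1 < g Λ)
    (hg : ∀ Λ, Λ₀ < Λ → g Λ ^ α + c₁ * log (g Λ) = c₂ + c₃ * log Λ) {lam : ℝ} (hlam : 0 < lam) :
    Tendsto (fun Λ : ℝ => g (lam * Λ) / g Λ) atTop (𝓝 1) := by
  obtain ⟨hk0, hk, hgk⟩ := exp_add_linear_of_rpow_add_log hΛ₀ hg1 hg
  have h := (tendsto_exp_sub_of_exp_add_linear hα hc₃ hk0 hk (log lam)).comp tendsto_log_atTop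
  refine h.congr' ?_
  filter_upwards [eventually_gt_atTop 0, tendsto_log_atTop.eventually_gt_atTop (log Λ₀),
    tendsto_log_atTop.eventually_gt_atTop (log Λ₀ - log lam)] with Λ h0 h1 h2
  simp only [Function.comp_apply]
  rw [← hgk _ h1, ← hgk _ (by linarith), exp_add, exp_log h0, exp_log hlam, mul_comm]

lemma tendsto_rpow_neg_atTop_nhdsGT_zero {s : ℝ} (hs : 0 < s) :
    Tendsto (fun r : ℝ => r ^ (-s)) atTop (𝓝[>] 0) := by
  refine tendsto_nhdsWithin_iff.2 ⟨tendsto_rpow_neg_atTop hs, ?_⟩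
  filter_upwards [eventually_gt_atTop 0] with r hr using rpow_pos_of_pos hr _

/-- The two-sided density estimate along a ray. -/
lemma eventually_log_weibullCPDensity_bounds (i : Fin n) (hα : 1 < α) {Λ₀ K : ℝ} {g : ℝ → ℝ}
    (hK : K = (log (α - 1) + n * log α - n * log (2 * π)) / 2)
    (hΛ₀ : 0 < Λ₀) (hg1 : ∀ Λ, Λ₀ < Λ → 1 < g Λ)
    (hg : ∀ Λ, Λ₀ < Λ →
      (α - 1) * g Λ ^ α + (1 + n * (1 - α / 2)) * log (g Λ) = K + log Λ)
    {δ ρ γ : ℝ} (hδ : 0 < δ) (hργ : ρ < γ) (hγ : γ < 1) :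
    ∀ᶠ N : ℝ in atTop, ∀ t ∈ Icc (N ^ ρ) (N ^ γ),
      -N * (α * g (N / t) ^ (α - 1) - (1 - δ) * (g (N / t))⁻¹) ≤
        log (weibullCPDensity n α t (N • EuclideanSpace.single i 1)) ∧
      log (weibullCPDensity n α t (N • EuclideanSpace.single i 1)) ≤
        -N * (α * g (N / t) ^ (α - 1) - (1 + δ) * (g (N / t))⁻¹) := by
  set e : EuclideanSpace ℝ (Fin n) := EuclideanSpace.single i 1 with he'
  have he : ‖e‖ = 1 := by simp [he']
  have hα1 : 0 < α - 1 := by linarith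
  have hgauss := integral_exp_neg_quadratic i hα
  rw [← hK, ← he'] at hgauss
  have hlim := (tendsto_integral_exp_neg_powBregman hα he).comp
    (tendsto_rpow_neg_atTop_nhdsGT_zero (s := α / 2) (by linarith))
  rw [hgauss] at hlim
  obtain ⟨R₁, hR₁⟩ := eventually_atTop.1 ((hlim.eventually_const_lt
    (u := exp (-K) / 2) (half_lt_self (exp_pos _))).and (hlim.eventually_lt_const
    (u := exp (-K) * (1 + δ / 2)) ((lt_mul_iff_one_lt_right (exp_pos _)).2 (by linarith))))
  set η := min (δ / 2) 1 with hη
  have hη0 : 0 < η := by positivity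
  obtain ⟨L, hL, hLev⟩ := exists_eventually_lt_integral_symTrunc hα he
    (I := exp (-K - η)) (by rw [hgauss]; exact exp_lt_exp.2 (by linarith))
  obtain ⟨R₂, hR₂⟩ := eventually_atTop.1
    ((tendsto_rpow_neg_atTop_nhdsGT_zero (s := α / 2) (by linarith)).eventually hLev)
  set a := ∫ z : EuclideanSpace ℝ (Fin n), weibullJump α z with ha
  set V := volume.real (Metric.ball (0 : EuclideanSpace ℝ (Fin n)) 1) with hV
  have ha0 : 0 ≤ a := integral_nonneg fun z => (exp_pos _).le
  set c := 1 + n * (1 - α / 2) with hc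
  set A₁ := a + 2 * (α - 1) + 6 * |c| + 1 + (n + 1) + n * |log L| + n * |1 - α / 2| + |log V|
    with hA₁
  set A₂ := |n * (1 - α / 2)| + |K + log 2| with hA₂
  have hA₁0 : 0 ≤ A₁ := by positivity
  have hA₂0 : 0 ≤ A₂ := by positivity
  have hg' : ∀ Λ, Λ₀ < Λ → g Λ ^ α + c / (α - 1) * log (g Λ) =
      K / (α - 1) + 1 / (α - 1) * log Λ := by
    intro Λ hΛ
    have := hg Λ hΛ
    field_simp
    linarith
  filter_upwards [eventually_forall_mem_Icc_of_rpow_add_log hα (by positivity) hΛ₀ hg1 hg' hργ hγ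
    (A := 2 / δ * (A₁ + A₂) + 1) (by positivity) (max R₁ (3 * max R₂ 1)),
    eventually_ge_atTop 1] with N hN hN1 t ht
  obtain ⟨ht0, hΛ, hR, hle⟩ := hN t ht
  have hG1 := hg1 _ hΛ
  have heq := hg _ hΛ
  set G := g (N / t)
  have hG0 : 0 < G := by linarith
  have hlogN := log_nonneg hN1
  have hlogG := log_nonneg hG1.le
  have hGα : G ≤ G ^ α := self_le_rpow_of_one_le hG1.le hα.le
  have hlogGα : log G ≤ G ^ α := by linarith [log_le_sub_one_of_pos hG0]
  have hX1 : 1 ≤ t + G ^ α + log N + 1 := by linarith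
  have hGX : log G ≤ t + G ^ α + log N + 1 := by linarith
  have hαX : G ^ α ≤ t + G ^ α + log N + 1 := by linarith
  have htX : t ≤ t + G ^ α + log N + 1 := by linarith
  have hNX : log N ≤ t + G ^ α + log N + 1 := by linarith
  set X := t + G ^ α + log N + 1
  have hGN : G ≤ N := by
    refine le_trans ?_ hle
    refine le_mul_of_one_le_left hG0.le (one_le_mul_of_one_le_of_one_le ?_ hX1)
    have : 0 ≤ 2 / δ * (A₁ + A₂) := by positivity
    linarith
  have hbd : (A₁ + A₂) * X ≤ δ / 2 * (N * G⁻¹) := by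
    have h1 : (2 / δ * (A₁ + A₂)) * X * G ≤ N := by
      refine le_trans ?_ hle
      gcongr
      linarith
    rw [← div_eq_mul_inv]
    rw [← le_div_iff₀ hG0] at h1
    calc (A₁ + A₂) * X = δ / 2 * ((2 / δ * (A₁ + A₂)) * X) := by field_simp
      _ ≤ _ := by gcongr
  have hA₁X := mul_nonneg hA₁0 (zero_le_one.trans hX1)
  have hA₂X := mul_nonneg hA₂0 (zero_le_one.trans hX1)
  constructor
  · refine le_log_weibullCPDensity_of_eq hα he (le_max_right R₂ 1) ((le_max_right _ _).trans hR)
      hGN ht0 hL (min_le_right _ _) (fun r hr => (hR₂ r ((le_max_left _ _).trans hr)).le) heq ?_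
    rw [← ha, ← hV, ← hc]
    have hηP : δ / 2 * (N * G⁻¹) ≤ (δ - η) * (N * G⁻¹) := by
      have : η ≤ δ / 2 := min_le_left _ _
      gcongr
      linarith
    refine le_trans (le_trans ?_ (by linarith : A₁ * X ≤ _)) hηP
    have e1 : a * t ≤ a * X := by gcongr
    have e2 : 2 * (α - 1) * G ^ α ≤ 2 * (α - 1) * X := by gcongr
    have e3 : 6 * |c| ≤ 6 * |c| * X := le_mul_of_one_le_right (by positivity) hX1
    have e4 : (n + 1) * log N ≤ (n + 1) * X := by gcongr
    have e5 : n * |log L| ≤ n * |log L| * X := le_mul_of_one_le_right (by positivity) hX1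
    have e6 : n * |1 - α / 2| * log G ≤ n * |1 - α / 2| * X := by gcongr
    have e7 : log V ≤ |log V| * X :=
      (le_abs_self _).trans (le_mul_of_one_le_right (by positivity) hX1)
    rw [hA₁]
    linarith
  · obtain ⟨hJ1, hJ2⟩ := hR₁ G ((le_max_left _ _).trans hR)
    simp only [Function.comp_apply] at hJ1 hJ2
    refine log_weibullCPDensity_le hα he hG1.le (by linarith) ht0 rfl heq ?_ ?_
    · refine (mul_le_mul_of_nonneg_right hJ2.le (exp_pos K).le).trans (le_of_eq ?_)
      rw [mul_right_comm, ← exp_add, neg_add_cancel, exp_zero, one_mul]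
    · refine le_trans ?_ (by linarith : A₂ * X ≤ _)
      have e1 := log_le_log (by positivity) hJ1.le
      rw [log_div (exp_pos _).ne' (by norm_num), log_exp] at e1
      have e2 : -(n * (1 - α / 2)) * log G ≤ |n * (1 - α / 2)| * X :=
        mul_le_mul (neg_le_abs _) hGX hlogG (abs_nonneg _)
      have e3 : K + log 2 ≤ |K + log 2| * X :=
        (le_abs_self _).trans (le_mul_of_one_le_right (by positivity) hX1)
      rw [hA₂]
      linarith

end Assembly

/-- Theorem 1.1.1: fine density estimates for the rescaled compound Poisson process with
Weibull-type jump density `exp (-‖z‖^α)`, where `g` solves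
`g(Λ)^α + C₁ ln g(Λ) = C₂ + C₃ ln Λ`; moreover `g` is slowly varying and `Λ ↦ g (e^Λ)` is
smoothly regularly varying of index `1/α`. -/
theorem stmt1 {n : ℕ} (hn : 0 < n) {α : ℝ} (hα : 1 < α)
    (y₀ Λ₀ : ℝ) (hy₀ : 1 ≤ y₀) (hΛ₀ : 0 < Λ₀) (g : ℝ → ℝ)
    (hg : ∀ Λ : ℝ, Λ₀ < Λ → y₀ < g Λ ∧
      g Λ ^ α + (2 - (α - 2) * n) / (2 * (α - 1)) * Real.log (g Λ)
        = (Real.log (α - 1) + n * Real.log α - n * Real.log (2 * π)) / (2 * (α - 1))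
          + 1 / (α - 1) * Real.log Λ)
    (hg_unique : ∀ Λ : ℝ, Λ₀ < Λ → ∀ y : ℝ, y₀ < y →
      y ^ α + (2 - (α - 2) * n) / (2 * (α - 1)) * Real.log y
        = (Real.log (α - 1) + n * Real.log α - n * Real.log (2 * π)) / (2 * (α - 1))
          + 1 / (α - 1) * Real.log Λ → y = g Λ) :
    (∀ δ > (0 : ℝ), ∀ ρ γ : ℝ, ρ < γ → γ < 1 →
      ∃ k > (0 : ℝ), ∀ y : EuclideanSpace ℝ (Fin n), k < ‖y‖ →
        ∀ t ∈ Set.Icc (‖y‖ ^ ρ) (‖y‖ ^ γ),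
          -‖y‖ * (α * g (‖y‖ / t) ^ (α - 1) - (1 - δ) * (g (‖y‖ / t))⁻¹)
              ≤ Real.log (weibullCPDensity n α t y) ∧
          Real.log (weibullCPDensity n α t y)
              ≤ -‖y‖ * (α * g (‖y‖ / t) ^ (α - 1) - (1 + δ) * (g (‖y‖ / t))⁻¹)) ∧
    (∀ lam > (0 : ℝ),
      Filter.Tendsto (fun Λ : ℝ => g (lam * Λ) / g Λ) Filter.atTop (nhds 1)) ∧
    SmoothRegVary α⁻¹ (fun Λ : ℝ => g (Real.exp Λ)) := by
  have hα1 : 0 < α - 1 := by linarith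
  have hg1 : ∀ Λ, Λ₀ < Λ → 1 < g Λ := fun Λ hΛ => hy₀.trans_lt (hg Λ hΛ).1
  have hc₃ : 0 < 1 / (α - 1) := by positivity
  refine ⟨fun δ hδ ρ γ hργ hγ => ?_, fun lam hlam =>
    tendsto_slowlyVarying_of_rpow_add_log hα hc₃ hΛ₀ hg1 (fun Λ hΛ => (hg Λ hΛ).2) hlam, ?_⟩
  · have hev := eventually_log_weibullCPDensity_bounds (⟨0, hn⟩ : Fin n) hα rfl hΛ₀ hg1
      (fun Λ hΛ => ?_) hδ hργ hγ
    · obtain ⟨k, hk⟩ := eventually_atTop.1 hev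
      refine ⟨max k 1, by positivity, fun y hy t ht => ?_⟩
      rw [weibullCPDensity_eq_of_norm_eq t
        (z := ‖y‖ • EuclideanSpace.single (⟨0, hn⟩ : Fin n) (1 : ℝ)) (by simp [norm_smul])]
      exact hk ‖y‖ ((le_max_left _ _).trans hy.le) t ht
    · have h := (hg Λ hΛ).2
      field_simp at h
      linarith
  · obtain ⟨hk0, hk, hgk⟩ :=
      exp_add_linear_of_rpow_add_log hΛ₀ hg1 fun Λ hΛ => (hg Λ hΛ).2
    exact smoothRegVary_of_exp_add_linear hα hc₃ hk0 hk hgk
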